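/- arXiv:1809.05931 — 3 statements merged into one kernel-verified Lean document; each statement's English description precedes it below -/
import Mathlib

section
/- For every integer k ≥ 1, every y = (y₁,…,y_k) ∈ [0,∞)^k and every u ∈ ℝ, lim_{n→∞} ∫₀^∞ e^{iut} R_β⁽ⁿ⁾(γₙ t, k, y) dt = (Σ_{j=1}^k y_j) ∫₀^∞ e^{iut} (1/σ) exp(−((b+m)/(σλ) + β) t) dt. -/
open MeasureTheory Filter Set

noncomputable def convIter (f : ℝ → ℝ) : ℕ → ℝ → ℝ
  | 0 => f
  | (k + 1) => fun t => ∫ s in (0:ℝ)..t, convIter f k (t - s) * f s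

noncomputable def resolventFn (a : ℝ) (f : ℝ → ℝ) (t : ℝ) : ℝ :=
  ∑' k : ℕ, a ^ (k + 1) * convIter f k t

noncomputable def resolventK (lamn γn β : ℝ) (R : ℝ → ℝ) {k : ℕ}
    (y : Fin k → ℝ) (t : ℝ) : ℝ :=
  lamn * Real.exp (-(β * t) / γn) * (∑ j, if t < y j then (1:ℝ) else 0)
    + lamn * ∫ s in (0:ℝ)..t,
        (R (t - s) * Real.exp (-(β * s) / γn) * (∑ j, if s < y j then (1:ℝ) else 0))

open MeasureTheory Filter Set

lemma aux_conv_int {h g : ℝ → ℝ} (hh : IntegrableOn h (Ioi 0)) (hg : IntegrableOn g (Ioi 0)) :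
    IntegrableOn (fun t => ∫ s in (0:ℝ)..t, h (t - s) * g s) (Ioi 0) := by
  have h1 := integrable_posConvolution (μ := volume) (ν := volume) hg hh
    (ContinuousLinearMap.mul ℝ ℝ)
  unfold posConvolution at h1
  rw [integrable_indicator_iff measurableSet_Ioi] at h1
  simpa [mul_comm] using h1

lemma aux_conv_real {h g : ℝ → ℝ} (hh : IntegrableOn h (Ioi 0)) (hg : IntegrableOn g (Ioi 0)) :
    ∫ t in Ioi (0:ℝ), (∫ s in (0:ℝ)..t, h (t - s) * g s) =
      (∫ t in Ioi (0:ℝ), h t) * ∫ t in Ioi (0:ℝ), g t := by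
  have h1 := integral_posConvolution (μ := volume) (ν := volume) hg hh
    (ContinuousLinearMap.mul ℝ ℝ)
  simpa [mul_comm] using h1

lemma aux_norm_E (w t : ℝ) : ‖Complex.exp (Complex.I * w * t)‖ = 1 := by
  rw [Complex.norm_exp]; simp

lemma aux_E_int (w : ℝ) {h : ℝ → ℝ} (hh : IntegrableOn h (Ioi 0)) :
    IntegrableOn (fun t : ℝ => Complex.exp (Complex.I * w * t) * (h t : ℂ)) (Ioi 0) := by
  refine Integrable.bdd_mul (c := 1) (Integrable.ofReal hh) ?_ ?_
  · exact (by fun_prop : Continuous fun t : ℝ => Complex.exp (Complex.I * w * t)).aestronglyMeasurable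
  · exact Eventually.of_forall fun t => (aux_norm_E w t).le

lemma aux_conv_E (w : ℝ) {h g : ℝ → ℝ} (hh : IntegrableOn h (Ioi 0))
    (hg : IntegrableOn g (Ioi 0)) :
    ∫ t in Ioi (0:ℝ), Complex.exp (Complex.I * w * t) *
        ((∫ s in (0:ℝ)..t, h (t - s) * g s : ℝ) : ℂ) =
      (∫ t in Ioi (0:ℝ), Complex.exp (Complex.I * w * t) * (h t : ℂ)) *
        ∫ t in Ioi (0:ℝ), Complex.exp (Complex.I * w * t) * (g t : ℂ) := by
  have h1 := integral_posConvolution (μ := volume) (ν := volume) (aux_E_int w hg) (aux_E_int w hh)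
    (ContinuousLinearMap.mul ℝ ℂ)
  simp only [ContinuousLinearMap.mul_apply'] at h1
  rw [mul_comm (∫ t in Ioi (0:ℝ), _) (∫ t in Ioi (0:ℝ), _), ← h1]
  congr 1
  ext t
  rw [← intervalIntegral.integral_ofReal, ← intervalIntegral.integral_const_mul]
  congr 1
  ext s
  have : Complex.exp (Complex.I * w * t) =
      Complex.exp (Complex.I * w * s) * Complex.exp (Complex.I * w * (t - s : ℝ)) := by
    rw [← Complex.exp_add]; congr 1; push_cast; ring
  rw [this]; push_cast; ring

lemma aux_iter_nonneg {f : ℝ → ℝ} (hf : ∀ t, 0 ≤ f t) (k : ℕ) :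
    ∀ t, 0 ≤ t → 0 ≤ convIter f k t := by
  induction k with
  | zero => intro t _; exact hf t
  | succ k ih =>
    intro t ht
    simp only [convIter]
    apply intervalIntegral.integral_nonneg ht
    intro s hs
    exact mul_nonneg (ih _ (by linarith [hs.2])) (hf s)

lemma aux_iter_int {f : ℝ → ℝ} (hf : IntegrableOn f (Ioi 0)) (k : ℕ) :
    IntegrableOn (convIter f k) (Ioi 0) := by
  induction k with
  | zero => exact hf
  | succ k ih => exact aux_conv_int ih hf

lemma aux_iter_real {f : ℝ → ℝ} (hf : IntegrableOn f (Ioi 0)) (k : ℕ) :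
    ∫ t in Ioi (0:ℝ), convIter f k t = (∫ t in Ioi (0:ℝ), f t) ^ (k + 1) := by
  induction k with
  | zero => simp [convIter]
  | succ k ih =>
    simp only [convIter]
    rw [aux_conv_real (aux_iter_int hf k) hf, ih]; ring

lemma aux_iter_E (w : ℝ) {f : ℝ → ℝ} (hf : IntegrableOn f (Ioi 0)) (k : ℕ) :
    ∫ t in Ioi (0:ℝ), Complex.exp (Complex.I * w * t) * (convIter f k t : ℂ) =
      (∫ t in Ioi (0:ℝ), Complex.exp (Complex.I * w * t) * (f t : ℂ)) ^ (k + 1) := by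
  induction k with
  | zero => simp [convIter]
  | succ k ih =>
    simp only [convIter]
    rw [aux_conv_E w (aux_iter_int hf k) hf, ih]; ring

lemma aux_res_E (w a : ℝ) (ha : 0 ≤ a) {f : ℝ → ℝ} (hf0 : ∀ t, 0 ≤ f t)
    (hf : IntegrableOn f (Ioi 0)) (hlt : a * ∫ t in Ioi (0:ℝ), f t < 1) :
    (∫ t in Ioi (0:ℝ), Complex.exp (Complex.I * w * t) * (resolventFn a f t : ℂ)) =
      (1 - a * ∫ t in Ioi (0:ℝ), Complex.exp (Complex.I * w * t) * (f t : ℂ))⁻¹ - 1 := by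
  set z : ℂ := ∫ t in Ioi (0:ℝ), Complex.exp (Complex.I * w * t) * (f t : ℂ) with hz
  set F : ℝ := ∫ t in Ioi (0:ℝ), f t with hF
  have hF0 : 0 ≤ F := setIntegral_nonneg measurableSet_Ioi fun t _ => hf0 t
  have hzF : ‖z‖ ≤ F := by
    refine (norm_integral_le_integral_norm _).trans (le_of_eq ?_)
    congr 1; ext t
    rw [norm_mul, aux_norm_E, one_mul, Complex.norm_real, Real.norm_of_nonneg (hf0 t)]
  have haz : ‖(a:ℂ) * z‖ < 1 := by
    rw [norm_mul, Complex.norm_real, Real.norm_of_nonneg ha]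
    exact lt_of_le_of_lt (mul_le_mul_of_nonneg_left hzF ha) hlt
  have key := hasSum_integral_of_summable_integral_norm
    (μ := volume.restrict (Ioi (0:ℝ)))
    (F := fun (k : ℕ) (t : ℝ) => Complex.exp (Complex.I * w * t) *
      ((a ^ (k + 1) * convIter f k t : ℝ) : ℂ))
    (fun k => aux_E_int w ((aux_iter_int hf k).const_mul _))
    (by
      have : ∀ k : ℕ, (∫ t in Ioi (0:ℝ), ‖Complex.exp (Complex.I * w * t) *
          ((a ^ (k + 1) * convIter f k t : ℝ) : ℂ)‖) = (a * F) * (a * F) ^ k := by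
        intro k
        rw [show (a * F) * (a * F) ^ k = a ^ (k+1) * F ^ (k+1) by ring, hF, ← aux_iter_real hf k,
          ← integral_const_mul]
        apply setIntegral_congr_fun measurableSet_Ioi
        intro t ht
        simp only
        rw [norm_mul, aux_norm_E, one_mul, Complex.norm_real, Real.norm_of_nonneg]
        exact mul_nonneg (pow_nonneg ha _) (aux_iter_nonneg hf0 k t (le_of_lt ht))
      simp_rw [this]
      exact (summable_geometric_of_lt_one (mul_nonneg ha hF0) hlt).mul_left _)
  have h1 : ∀ k : ℕ, (∫ t in Ioi (0:ℝ), Complex.exp (Complex.I * w * t) *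
      ((a ^ (k + 1) * convIter f k t : ℝ) : ℂ)) = (a * z) * (a * z) ^ k := by
    intro k
    rw [show (a * z) * (a * z) ^ k = (a:ℂ) ^ (k+1) * z ^ (k+1) by ring, hz, ← aux_iter_E w hf k,
      ← integral_const_mul]
    congr 1; ext t; push_cast; ring
  simp_rw [h1] at key
  have h2 := (hasSum_geometric_of_norm_lt_one haz).mul_left ((a:ℂ) * z)
  have h3 := key.unique h2
  have hne : (1 - (a:ℂ) * z) ≠ 0 := by
    intro h
    have : (a:ℂ) * z = 1 := (sub_eq_zero.mp h).symm
    rw [this] at haz; simp at haz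
  have h4 : (a:ℂ) * z * (1 - a * z)⁻¹ = (1 - a * z)⁻¹ - 1 := by
    field_simp; ring
  rw [← h4, ← h3]
  congr 1; ext t
  rw [tsum_mul_left]
  simp only [resolventFn, Complex.ofReal_tsum]

lemma aux_res_int (a : ℝ) (ha : 0 < a) {f : ℝ → ℝ} (hf0 : ∀ t, 0 ≤ f t)
    (hf : IntegrableOn f (Ioi 0)) (hlt : a * ∫ t in Ioi (0:ℝ), f t < 1)
    (hpos : 0 < a * ∫ t in Ioi (0:ℝ), f t) :
    IntegrableOn (resolventFn a f) (Ioi 0) := by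
  have h := aux_res_E 0 a ha.le hf0 hf hlt
  simp only [Complex.ofReal_zero, mul_zero, zero_mul, Complex.exp_zero, one_mul] at h
  rw [integral_complex_ofReal, integral_complex_ofReal] at h
  by_contra hc
  rw [integral_undef hc] at h
  norm_cast at h
  set x := a * ∫ t in Ioi (0:ℝ), f t
  have h1 : (1 - x)⁻¹ = 1 := by linarith
  rw [inv_eq_one] at h1
  linarith

lemma aux_K_E (w lamn γn β : ℝ) {R : ℝ → ℝ} (hR : IntegrableOn R (Ioi 0)) {k : ℕ} (y : Fin k → ℝ)
    (hg : IntegrableOn (fun s => Real.exp (-(β * s) / γn) *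
      (∑ j, if s < y j then (1:ℝ) else 0)) (Ioi 0)) :
    ∫ t in Ioi (0:ℝ), Complex.exp (Complex.I * w * t) *
        (resolventK lamn γn β R y t : ℂ) =
      lamn * ((1 + ∫ t in Ioi (0:ℝ), Complex.exp (Complex.I * w * t) * (R t : ℂ)) *
        ∫ t in Ioi (0:ℝ), Complex.exp (Complex.I * w * t) *
          ((Real.exp (-(β * t) / γn) * (∑ j, if t < y j then (1:ℝ) else 0) : ℝ) : ℂ)) := by
  rw [add_mul, one_mul, ← aux_conv_E w hR hg, ← integral_add (aux_E_int w hg)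
    (aux_E_int w (aux_conv_int hR hg)), ← integral_const_mul]
  congr 1; ext t
  simp only [resolventK, mul_assoc]
  push_cast; ring

lemma aux_tail (μ : Measure ℝ) [IsProbabilityMeasure μ] (hs : μ (Iio 0) = 0) (p : ℝ) (hp : 0 < p)
    (hi : Integrable (fun t : ℝ => t ^ p) μ) :
    IntegrableOn (fun t => t ^ (p - 1) * (μ (Ioi t)).toReal) (Ioi 0) ∧
    ∫ t in Ioi (0:ℝ), t ^ (p - 1) * (μ (Ioi t)).toReal = p⁻¹ * ∫ t, t ^ p ∂μ := by
  have hnn : ∀ᵐ t ∂μ, 0 ≤ t := by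
    rw [ae_iff]; convert hs using 2; ext; simp
  have key := lintegral_rpow_eq_lintegral_meas_lt_mul μ (f := fun t => t) hnn (by fun_prop) hp
  have e1 : ∫⁻ t in Ioi (0:ℝ), μ {a | t < a} * ENNReal.ofReal (t ^ (p - 1)) =
      ∫⁻ t in Ioi (0:ℝ), ENNReal.ofReal (t ^ (p - 1) * (μ (Ioi t)).toReal) := by
    apply setLIntegral_congr_fun measurableSet_Ioi
    intro t ht
    simp only
    rw [ENNReal.ofReal_mul (Real.rpow_nonneg (le_of_lt ht) _), ENNReal.ofReal_toReal (by finiteness),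
      mul_comm]
    rfl
  rw [e1] at key
  have hmeas : Measurable (fun t => t ^ (p - 1) * (μ (Ioi t)).toReal) := by
    refine Measurable.mul (by fun_prop) (Measurable.ennreal_toReal ?_)
    apply Antitone.measurable
    intro s t hst
    exact measure_mono (Ioi_subset_Ioi hst)
  have hnn2 : 0 ≤ᵐ[volume.restrict (Ioi (0:ℝ))] fun t => t ^ (p - 1) * (μ (Ioi t)).toReal := by
    filter_upwards [ae_restrict_mem measurableSet_Ioi] with t ht
    exact mul_nonneg (Real.rpow_nonneg (le_of_lt ht) _) ENNReal.toReal_nonneg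
  have hfin : ∫⁻ t, ENNReal.ofReal (t ^ p) ∂μ < ⊤ := hi.lintegral_lt_top
  constructor
  · refine ⟨hmeas.aestronglyMeasurable, ?_⟩
    rw [hasFiniteIntegral_iff_ofReal hnn2]
    rw [key] at hfin
    by_contra hc
    rw [not_lt, top_le_iff] at hc
    rw [hc, ENNReal.mul_top (by simpa using hp)] at hfin
    exact lt_irrefl _ hfin
  · rw [integral_eq_lintegral_of_nonneg_ae hnn2 hmeas.aestronglyMeasurable,
      integral_eq_lintegral_of_nonneg_ae (by filter_upwards [hnn] with t ht using Real.rpow_nonneg ht p)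
        hi.1, key, ENNReal.toReal_mul, ENNReal.toReal_ofReal hp.le]
    field_simp

lemma aux_exp_bound {z : ℂ} (hz : z.re ≤ 0) : ‖Complex.exp z - 1‖ ≤ 2 * ‖z‖ := by
  rcases le_total ‖z‖ 1 with h | h
  · exact Complex.norm_exp_sub_one_le h
  · refine (norm_sub_le _ _).trans ?_
    have : ‖Complex.exp z‖ ≤ 1 := by rw [Complex.norm_exp]; exact Real.exp_le_one_iff.mpr hz
    rw [norm_one]; linarith

lemma aux_exp_norm_le {z : ℂ} (hz : z.re ≤ 0) {γ s : ℝ} (hγ : 0 < γ) (hs : 0 ≤ s) :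
    ‖Complex.exp (z * s / γ)‖ ≤ 1 := by
  rw [Complex.norm_exp, Real.exp_le_one_iff, Complex.div_ofReal_re, Complex.re_mul_ofReal]
  exact div_nonpos_of_nonpos_of_nonneg (mul_nonpos_of_nonpos_of_nonneg hz hs) hγ.le

lemma aux_denom (z : ℂ) (hz : z.re ≤ 0) (γ a : ℕ → ℝ) (B : ℕ → ℝ → ℝ) (D : ℝ → ℝ)
    (hγ : ∀ n, 0 < γ n) (hγt : Tendsto γ atTop atTop)
    (hB0 : ∀ n t, 0 ≤ B n t) (hBD : ∀ n t, 0 ≤ t → B n t ≤ D t)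
    (hBm : ∀ n, Measurable (B n))
    (hB1 : ∀ n, IntegrableOn (B n) (Ioi 0))
    (hB2 : ∀ n, IntegrableOn (fun s => s * B n s) (Ioi 0))
    (hD : IntegrableOn (fun s => s * D s) (Ioi 0))
    (bm a0 σ0 : ℝ) (ha : Tendsto a atTop (nhds a0))
    (h1 : Tendsto (fun n => γ n * (1 - a n * ∫ s in Ioi (0:ℝ), B n s)) atTop (nhds bm))
    (h2 : Tendsto (fun n => ∫ s in Ioi (0:ℝ), s * B n s) atTop (nhds σ0)) :
    Tendsto (fun n => (γ n : ℂ) * (1 - a n * ∫ s in Ioi (0:ℝ),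
      Complex.exp (z * s / γ n) * (B n s : ℂ))) atTop (nhds (bm - a0 * z * σ0)) := by
  have hint : ∀ n, IntegrableOn (fun s : ℝ => Complex.exp (z * s / γ n) * (B n s : ℂ)) (Ioi 0) := by
    intro n
    refine Integrable.bdd_mul (c := 1) (Integrable.ofReal (hB1 n)) ?_ ?_
    · exact (by fun_prop : Continuous fun s : ℝ =>
        Complex.exp (z * s / γ n)).aestronglyMeasurable
    · filter_upwards [ae_restrict_mem measurableSet_Ioi] with s hs
      exact aux_exp_norm_le hz (hγ n) (le_of_lt hs)
  have hD0 : ∀ t, 0 ≤ t → 0 ≤ D t := fun t ht => (hB0 0 t).trans (hBD 0 t ht)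
  have hrem : Tendsto (fun n => ∫ s in Ioi (0:ℝ),
      ((γ n : ℂ) * (Complex.exp (z * s / γ n) - 1) - z * s) * (B n s : ℂ)) atTop (nhds 0) := by
    have := tendsto_integral_of_dominated_convergence (μ := volume.restrict (Ioi (0:ℝ)))
      (F := fun n s => ((γ n : ℂ) * (Complex.exp (z * s / γ n) - 1) - z * s) * (B n s : ℂ))
      (f := fun _ => 0) (bound := fun s => (3 * ‖z‖) * (s * D s)) ?_ ?_ ?_ ?_
    · simpa using this
    · intro n
      exact ((by fun_prop : Measurable fun s : ℝ =>
        ((γ n : ℂ) * (Complex.exp (z * s / γ n) - 1) - z * s)).mul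
          (hBm n).complex_ofReal).aestronglyMeasurable
    · exact hD.const_mul _
    · intro n
      filter_upwards [ae_restrict_mem measurableSet_Ioi] with s hs
      have hs0 : 0 ≤ s := le_of_lt hs
      have hg := hγ n
      have e1 : ‖(γ n : ℂ) * (Complex.exp (z * s / γ n) - 1)‖ ≤ 2 * (‖z‖ * s) := by
        rw [norm_mul, Complex.norm_real, Real.norm_of_nonneg hg.le]
        have := aux_exp_bound (z := z * s / γ n) (by
          rw [Complex.div_ofReal_re, Complex.re_mul_ofReal]
          exact div_nonpos_of_nonpos_of_nonneg (mul_nonpos_of_nonpos_of_nonneg hz hs0) hg.le)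
        rw [norm_div, norm_mul, Complex.norm_real, Complex.norm_real, Real.norm_of_nonneg hg.le,
          Real.norm_of_nonneg hs0] at this
        calc _ ≤ γ n * (2 * (‖z‖ * s / γ n)) := mul_le_mul_of_nonneg_left this hg.le
          _ = _ := by field_simp
      have e2 : ‖z * (s:ℂ)‖ = ‖z‖ * s := by
        rw [norm_mul, Complex.norm_real, Real.norm_of_nonneg hs0]
      rw [norm_mul, Complex.norm_real, Real.norm_of_nonneg (hB0 n s)]
      calc _ ≤ (3 * (‖z‖ * s)) * D s := by
            refine mul_le_mul ?_ (hBD n s hs0) (hB0 n s) (by positivity)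
            refine (norm_sub_le _ _).trans ?_
            rw [e2]; linarith
        _ = _ := by ring
    · filter_upwards [ae_restrict_mem measurableSet_Ioi] with s hs
      have hs0 : 0 ≤ s := le_of_lt hs
      have hb : Tendsto (fun n => (‖z‖ * s) ^ 2 / γ n * D s) atTop (nhds 0) := by
        simpa using (hγt.const_div_atTop ((‖z‖ * s) ^ 2)).mul_const (D s)
      refine squeeze_zero_norm' ?_ hb
      filter_upwards [hγt.eventually_ge_atTop (‖z‖ * s)] with n hn
      have hg := hγ n
      have e2 : ‖z * (s:ℂ) / γ n‖ = ‖z‖ * s / γ n := by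
        rw [norm_div, norm_mul, Complex.norm_real, Complex.norm_real, Real.norm_of_nonneg hg.le,
          Real.norm_of_nonneg hs0]
      have := Complex.norm_exp_sub_one_sub_id_le (x := z * s / γ n) (by
        rw [e2]; exact (div_le_one hg).mpr hn)
      rw [e2] at this
      have hgc : (γ n : ℂ) ≠ 0 := by exact_mod_cast hg.ne'
      have e3 : (γ n : ℂ) * (Complex.exp (z * s / γ n) - 1) - z * s =
          γ n * (Complex.exp (z * s / γ n) - 1 - z * s / γ n) := by
        field_simp
      rw [norm_mul, Complex.norm_real, Real.norm_of_nonneg (hB0 n s), e3, norm_mul,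
        Complex.norm_real, Real.norm_of_nonneg hg.le]
      refine mul_le_mul ?_ (hBD n s hs0) (hB0 n s) (by positivity)
      calc _ ≤ γ n * (‖z‖ * s / γ n) ^ 2 := mul_le_mul_of_nonneg_left this hg.le
        _ = _ := by field_simp
  have hac : Tendsto (fun n => (a n : ℂ)) atTop (nhds (a0 : ℂ)) :=
    (Complex.continuous_ofReal.tendsto _).comp ha
  have h1c := (Complex.continuous_ofReal.tendsto _).comp h1
  have h2c := (Complex.continuous_ofReal.tendsto _).comp h2
  have hfin := (h1c.sub (hac.mul hrem)).sub ((hac.mul_const z).mul h2c)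
  rw [mul_zero, sub_zero] at hfin
  refine hfin.congr fun n => ?_
  have hi2 : IntegrableOn (fun s : ℝ => z * ((s * B n s : ℝ) : ℂ)) (Ioi 0) :=
    (Integrable.ofReal (hB2 n)).const_mul z
  have hi1 : IntegrableOn (fun s : ℝ => ((B n s : ℝ) : ℂ)) (Ioi 0) := Integrable.ofReal (hB1 n)
  have hi3 : IntegrableOn (fun s : ℝ => (γ n : ℂ) * (Complex.exp (z * s / γ n) * (B n s : ℂ)) -
      (γ n : ℂ) * (B n s : ℂ)) (Ioi 0) := ((hint n).const_mul _).sub (hi1.const_mul _)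
  have e : (∫ s in Ioi (0:ℝ),
      ((γ n : ℂ) * (Complex.exp (z * s / γ n) - 1) - z * s) * (B n s : ℂ)) =
      γ n * (∫ s in Ioi (0:ℝ), Complex.exp (z * s / γ n) * (B n s : ℂ)) -
      γ n * ((∫ s in Ioi (0:ℝ), B n s : ℝ) : ℂ) - z * ((∫ s in Ioi (0:ℝ), s * B n s : ℝ) : ℂ) := by
    rw [← integral_complex_ofReal, ← integral_complex_ofReal, ← integral_const_mul,
      ← integral_const_mul, ← integral_const_mul, ← integral_sub ((hint n).const_mul _)
      (hi1.const_mul _), ← integral_sub hi3 hi2]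
    congr 1; ext s; push_cast; ring
  simp only [Function.comp]
  rw [e]; push_cast; ring

lemma aux_step_int {k : ℕ} (y : Fin k → ℝ) (hy : ∀ j, 0 ≤ y j) :
    IntegrableOn (fun s => ∑ j, if s < y j then (1:ℝ) else 0) (Ioi 0) ∧
    ∫ s in Ioi (0:ℝ), (∑ j, if s < y j then (1:ℝ) else 0) = ∑ j, y j := by
  have e : ∀ j, (fun s => if s < y j then (1:ℝ) else 0) = (Iio (y j)).indicator (fun _ => 1) := by
    intro j; ext s; simp [indicator]
  have hi : ∀ j, IntegrableOn (fun s => if s < y j then (1:ℝ) else 0) (Ioi 0) := by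
    intro j
    rw [e, IntegrableOn, integrable_indicator_iff measurableSet_Iio, IntegrableOn,
      Measure.restrict_restrict measurableSet_Iio, inter_comm, Ioi_inter_Iio]
    exact integrableOn_const (by simp)
  refine ⟨integrable_finsetSum _ fun j _ => hi j, ?_⟩
  rw [integral_finsetSum _ fun j _ => hi j]
  refine Finset.sum_congr rfl fun j _ => ?_
  rw [e, integral_indicator measurableSet_Iio, Measure.restrict_restrict measurableSet_Iio,
    inter_comm, Ioi_inter_Iio]
  simp [hy j]

lemma aux_step_lim (z : ℂ) (hz : z.re ≤ 0) (γ : ℕ → ℝ)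
    (hγ : ∀ n, 0 < γ n) (hγt : Tendsto γ atTop atTop) {k : ℕ} (y : Fin k → ℝ)
    (hy : ∀ j, 0 ≤ y j) :
    Tendsto (fun n => ∫ s in Ioi (0:ℝ), Complex.exp (z * s / γ n) *
      ((∑ j, if s < y j then (1:ℝ) else 0 : ℝ) : ℂ)) atTop (nhds ((∑ j, y j : ℝ) : ℂ)) := by
  obtain ⟨hi, he⟩ := aux_step_int y hy
  rw [← he, ← integral_complex_ofReal]
  have hic := Integrable.ofReal (𝕜 := ℂ) hi
  refine tendsto_integral_of_dominated_convergence
    (fun s => ∑ j, if s < y j then (1:ℝ) else 0) ?_ hi ?_ ?_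
  · intro n
    exact (by fun_prop : Continuous fun s : ℝ =>
      Complex.exp (z * s / γ n)).aestronglyMeasurable.mul hic.1
  · intro n
    filter_upwards [ae_restrict_mem measurableSet_Ioi] with s hs
    have h0 : 0 ≤ ∑ j, if s < y j then (1:ℝ) else 0 :=
      Finset.sum_nonneg fun j _ => by split_ifs <;> norm_num
    rw [norm_mul, Complex.norm_real, Real.norm_of_nonneg h0]
    exact mul_le_of_le_one_left h0 (aux_exp_norm_le hz (hγ n) (le_of_lt hs))
  · refine Eventually.of_forall fun s => ?_
    have h1 : Tendsto (fun n => z * s / (γ n : ℂ)) atTop (nhds 0) := by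
      rw [tendsto_zero_iff_norm_tendsto_zero]
      have := hγt.const_div_atTop ‖z * (s:ℂ)‖
      refine this.congr fun n => ?_
      rw [norm_div, Complex.norm_real, Real.norm_of_nonneg (hγ n).le]
    have h2 := (Complex.continuous_exp.tendsto _).comp h1
    rw [Complex.exp_zero] at h2
    simpa using h2.mul_const ((∑ j, if s < y j then (1:ℝ) else 0 : ℝ) : ℂ)

theorem stmt11
    (β α : ℝ) (hβ : 0 ≤ β) (hα : α ∈ Set.Ioo (1:ℝ) 2)
    (Λ : ℕ → Measure ℝ) (hΛprob : ∀ n, IsProbabilityMeasure (Λ n))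
    (hΛsupp : ∀ n, Λ n (Set.Iio 0) = 0)
    (lam m γ : ℕ → ℝ)
    (hlam_pos : ∀ n, 0 < lam n) (hm_pos : ∀ n, 0 < m n) (hγ_pos : ∀ n, 0 < γ n)
    (hγ_top : Tendsto γ atTop atTop)
    (Λbar : ℕ → ℝ → ℝ) (hΛbar : ∀ n t, Λbar n t = (Λ n (Set.Ioi t)).toReal)
    (Λbarβ : ℕ → ℝ → ℝ)
    (hΛbarβ : ∀ n t, Λbarβ n t = Real.exp (-(β * t) / γ n) * Λbar n t)
    (ηβ : ℕ → ℝ) (hηβ : ∀ n, ηβ n = ∫ t in Set.Ioi (0:ℝ), Λbarβ n t)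
    (lam0 η0 σ0 bm : ℝ) (hlam0 : 0 < lam0) (hη0 : 0 < η0) (hσ0 : 0 < σ0)
    (hbm_pos : 0 < bm + β * σ0 * lam0)
    (hmom1 : ∀ n, Integrable (fun t => t) (Λ n))
    (hmom2 : ∀ n, Integrable (fun t => t ^ 2) (Λ n))
    (hlam_lim : Tendsto lam atTop (nhds lam0))
    (hm_lim : Tendsto m atTop (nhds 1))
    (hmean_lim : Tendsto (fun n => ∫ t, t ∂(Λ n)) atTop (nhds η0))
    (hsec_lim : Tendsto (fun n => (1/2) * ∫ t, t ^ 2 ∂(Λ n)) atTop (nhds σ0))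
    (hγ_lim : Tendsto (fun n => γ n * (1 - lam n * m n * ∫ t, t ∂(Λ n))) atTop (nhds bm))
    (C₀ : ℝ) (hC₀ : 0 < C₀)
    (Λstar : Measure ℝ) (hstar_prob : IsProbabilityMeasure Λstar)
    (hstar_supp : Λstar (Set.Iio 0) = 0)
    (hstar_mom : Integrable (fun t => t ^ (2 * α)) Λstar)
    (hdom : ∀ n, ∀ t : ℝ, 0 ≤ t → Λbar n t ≤ C₀ * (Λstar (Set.Ioi t)).toReal)
    (Rβ : ℕ → ℝ → ℝ) (hRβ : ∀ n t, Rβ n t = resolventFn (lam n * m n) (Λbarβ n) t)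
 :
    ∀ k : ℕ, 1 ≤ k → ∀ y : Fin k → ℝ, (∀ j, 0 ≤ y j) → ∀ u : ℝ,
      Tendsto (fun n => ∫ t in Set.Ioi (0:ℝ),
          Complex.exp (Complex.I * u * t) *
            Complex.ofReal (resolventK (lam n) (γ n) β (Rβ n) y (γ n * t))) atTop
        (nhds (Complex.ofReal (∑ j, y j) * ∫ t in Set.Ioi (0:ℝ),
          Complex.exp (Complex.I * u * t) *
            Complex.ofReal ((1 / σ0) * Real.exp (-(bm / (σ0 * lam0) + β) * t)))) := by
  intro k hk y hy u
  have hBar0 : ∀ n t, 0 ≤ Λbar n t := fun n t => by rw [hΛbar]; exact ENNReal.toReal_nonneg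
  have hBarm : ∀ n, Measurable (Λbar n) := by
    intro n
    have : Λbar n = fun t => (Λ n (Ioi t)).toReal := funext (hΛbar n)
    rw [this]
    refine Measurable.ennreal_toReal (Antitone.measurable ?_)
    intro s t hst
    exact measure_mono (Ioi_subset_Ioi hst)
  have hT1 : ∀ n, IntegrableOn (Λbar n) (Ioi 0) ∧
      ∫ t in Ioi (0:ℝ), Λbar n t = ∫ t, t ∂(Λ n) := by
    intro n
    have := hΛprob n
    have h := aux_tail (Λ n) (hΛsupp n) 1 one_pos (by simpa using hmom1 n)
    have e : Λbar n = fun t => (Λ n (Ioi t)).toReal := funext (hΛbar n)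
    rw [e]
    simpa using h
  have hT2 : ∀ n, IntegrableOn (fun s => s * Λbar n s) (Ioi 0) ∧
      ∫ t in Ioi (0:ℝ), t * Λbar n t = (1/2) * ∫ t, t ^ 2 ∂(Λ n) := by
    intro n
    have := hΛprob n
    have h := aux_tail (Λ n) (hΛsupp n) 2 two_pos (by simpa using hmom2 n)
    have e : Λbar n = fun t => (Λ n (Ioi t)).toReal := funext (hΛbar n)
    rw [e]
    norm_num at h ⊢
    exact h
  have hstar2 : Integrable (fun t : ℝ => t ^ (2:ℝ)) Λstar := by
    have hnn : ∀ᵐ t ∂Λstar, 0 ≤ t := by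
      rw [ae_iff]; convert hstar_supp using 2; ext; simp
    refine Integrable.mono' (hstar_mom.add (integrable_const (1:ℝ))) (by fun_prop) ?_
    filter_upwards [hnn] with t ht
    rw [Real.norm_of_nonneg (Real.rpow_nonneg ht _)]
    simp only [Pi.add_apply]
    rcases le_total t 1 with h | h
    · have := Real.rpow_le_one ht h (by norm_num : (0:ℝ) ≤ 2)
      have := Real.rpow_nonneg ht (2 * α)
      linarith
    · have := Real.rpow_le_rpow_of_exponent_le h (by linarith [hα.1] : (2:ℝ) ≤ 2 * α)
      linarith
  have hD : IntegrableOn (fun s => s * (C₀ * (Λstar (Ioi s)).toReal)) (Ioi 0) := by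
    have h := (aux_tail Λstar hstar_supp 2 two_pos hstar2).1.const_mul C₀
    norm_num at h
    refine h.congr (Eventually.of_forall fun s => ?_)
    simp only; ring
  have ha : Tendsto (fun n => lam n * m n) atTop (nhds lam0) := by
    simpa using hlam_lim.mul hm_lim
  have hden : ∀ v : ℝ, Tendsto (fun n => (γ n : ℂ) * (1 - ((lam n * m n : ℝ) : ℂ) *
      ∫ s in Ioi (0:ℝ), Complex.exp ((-β + Complex.I * v) * s / γ n) * (Λbar n s : ℂ))) atTop
      (nhds (bm - lam0 * (-β + Complex.I * v) * σ0)) := by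
    intro v
    refine aux_denom _ (by simpa using hβ) γ (fun n => lam n * m n) Λbar _ hγ_pos hγ_top hBar0 hdom hBarm
      (fun n => (hT1 n).1) (fun n => (hT2 n).1) hD bm lam0 σ0 ha ?_ ?_
    · simpa only [(hT1 _).2] using hγ_lim
    · simpa only [(hT2 _).2] using hsec_lim
  have hEe : ∀ (v : ℝ) n (s : ℝ), Complex.exp ((-β + Complex.I * v) * s / γ n) =
      Complex.exp (Complex.I * ((v / γ n : ℝ) : ℂ) * s) * (Real.exp (-(β * s) / γ n) : ℂ) := by
    intro v n s
    rw [Complex.ofReal_exp, ← Complex.exp_add]; congr 1; push_cast; ring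
  have hβ0 : ∀ n t, 0 ≤ Λbarβ n t := fun n t => by
    rw [hΛbarβ]; exact mul_nonneg (Real.exp_pos _).le (hBar0 n t)
  have hexp1 : ∀ n s, 0 ≤ s → Real.exp (-(β * s) / γ n) ≤ 1 := by
    intro n s hs
    rw [Real.exp_le_one_iff]
    exact div_nonpos_of_nonpos_of_nonneg (by nlinarith [mul_nonneg hβ hs]) (hγ_pos n).le
  have hbddint : ∀ n (g : ℝ → ℝ), IntegrableOn g (Ioi 0) →
      IntegrableOn (fun s => Real.exp (-(β * s) / γ n) * g s) (Ioi 0) := by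
    intro n g hg
    refine Integrable.bdd_mul (c := 1) hg ?_ ?_
    · exact (by fun_prop : Continuous fun s : ℝ =>
        Real.exp (-(β * s) / γ n)).aestronglyMeasurable
    · filter_upwards [ae_restrict_mem measurableSet_Ioi] with s hs
      rw [Real.norm_of_nonneg (Real.exp_pos _).le]
      exact hexp1 n s (le_of_lt hs)
  have hβint : ∀ n, IntegrableOn (Λbarβ n) (Ioi 0) := by
    intro n
    have e : Λbarβ n = fun s => Real.exp (-(β * s) / γ n) * Λbar n s := funext (hΛbarβ n)
    rw [e]; exact hbddint n _ (hT1 n).1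
  -- Laplace exponent identity
  have hfhat : ∀ (v : ℝ) n, (∫ s in Ioi (0:ℝ),
      Complex.exp ((-β + Complex.I * v) * s / γ n) * (Λbar n s : ℂ)) =
      ∫ s in Ioi (0:ℝ), Complex.exp (Complex.I * ((v / γ n : ℝ) : ℂ) * s) * (Λbarβ n s : ℂ) := by
    intro v n
    congr 1; ext s
    rw [hEe, hΛbarβ]; push_cast; ring
  -- real case
  have hreal : Tendsto (fun n => γ n * (1 - (lam n * m n) * ∫ s in Ioi (0:ℝ), Λbarβ n s)) atTop
      (nhds (bm + β * σ0 * lam0)) := by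
    have h := (Complex.continuous_re.tendsto _).comp (hden 0)
    have e : (bm - lam0 * (-β + Complex.I * (0:ℝ)) * σ0 : ℂ).re = bm + β * σ0 * lam0 := by
      have : (bm - lam0 * (-β + Complex.I * (0:ℝ)) * σ0 : ℂ) =
        ((bm + β * σ0 * lam0 : ℝ) : ℂ) := by push_cast; ring
      rw [this, Complex.ofReal_re]
    rw [e] at h
    refine h.congr fun n => ?_
    simp only [Function.comp]
    rw [hfhat]
    simp only [zero_div, Complex.ofReal_zero, mul_zero, zero_mul, Complex.exp_zero, one_mul]
    rw [integral_complex_ofReal]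
    norm_cast
  have hlt : ∀ᶠ n in atTop, (lam n * m n) * ∫ s in Ioi (0:ℝ), Λbarβ n s < 1 := by
    filter_upwards [hreal.eventually (lt_mem_nhds hbm_pos)] with n hn
    have := (pos_iff_pos_of_mul_pos hn).mp (hγ_pos n)
    linarith
  have hgt : ∀ᶠ n in atTop, 0 < (lam n * m n) * ∫ s in Ioi (0:ℝ), Λbarβ n s := by
    have h := hreal.div_atTop hγ_top
    filter_upwards [h.eventually (gt_mem_nhds one_pos)] with n hn
    rw [mul_div_cancel_left₀ _ (hγ_pos n).ne'] at hn
    linarith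
  obtain ⟨hgi, -⟩ := aux_step_int y hy
  -- the formula for large n
  have hform : ∀ᶠ n in atTop, (lam n : ℂ) * (∫ s in Ioi (0:ℝ),
        Complex.exp ((-β + Complex.I * u) * s / γ n) *
        ((∑ j, if s < y j then (1:ℝ) else 0 : ℝ) : ℂ)) /
      ((γ n : ℂ) * (1 - ((lam n * m n : ℝ) : ℂ) *
      ∫ s in Ioi (0:ℝ), Complex.exp ((-β + Complex.I * u) * s / γ n) * (Λbar n s : ℂ))) =
      ∫ t in Set.Ioi (0:ℝ), Complex.exp (Complex.I * u * t) *
            Complex.ofReal (resolventK (lam n) (γ n) β (Rβ n) y (γ n * t)) := by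
    filter_upwards [hlt, hgt] with n hl hg
    have hg0 := hγ_pos n
    have hap : 0 < lam n * m n := mul_pos (hlam_pos n) (hm_pos n)
    have hR : Rβ n = resolventFn (lam n * m n) (Λbarβ n) := funext (hRβ n)
    have hRi := aux_res_int (lam n * m n) hap (hβ0 n) (hβint n) hl hg
    have hRE := aux_res_E (u / γ n) (lam n * m n) hap.le (hβ0 n) (hβint n) hl
    rw [← hR] at hRi hRE
    have hK := aux_K_E (u / γ n) (lam n) (γ n) β hRi y (hbddint n _ hgi)
    have hsc := integral_comp_mul_left_Ioi (fun t : ℝ => Complex.exp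
      (Complex.I * ((u / γ n : ℝ) : ℂ) * t) *
        (resolventK (lam n) (γ n) β (Rβ n) y t : ℂ)) 0 hg0
    rw [mul_zero, hK, hRE, ← hfhat] at hsc
    have e1 : (∫ t in Set.Ioi (0:ℝ), Complex.exp (Complex.I * u * t) *
            Complex.ofReal (resolventK (lam n) (γ n) β (Rβ n) y (γ n * t))) =
        ∫ x in Ioi (0:ℝ), Complex.exp (Complex.I * ((u / γ n : ℝ) : ℂ) * ((γ n * x : ℝ) : ℂ)) *
        (resolventK (lam n) (γ n) β (Rβ n) y (γ n * x) : ℂ) := by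
      congr 1; ext t
      have hgc : (γ n : ℂ) ≠ 0 := by exact_mod_cast hg0.ne'
      congr 2
      push_cast; field_simp
    have e2 : (∫ s in Ioi (0:ℝ),
        Complex.exp ((-β + Complex.I * u) * s / γ n) *
        ((∑ j, if s < y j then (1:ℝ) else 0 : ℝ) : ℂ)) =
        ∫ t in Ioi (0:ℝ), Complex.exp (Complex.I * ((u / γ n : ℝ) : ℂ) * t) *
          ((Real.exp (-(β * t) / γ n) * (∑ j, if t < y j then (1:ℝ) else 0) : ℝ) : ℂ) := by
      congr 1; ext s
      rw [hEe]; push_cast; ring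
    rw [e1, hsc, e2, add_sub_cancel, Complex.real_smul, Complex.ofReal_inv, div_eq_mul_inv, mul_inv]
    ring
  refine Tendsto.congr' hform ?_
  have hlc : Tendsto (fun n => (lam n : ℂ)) atTop (nhds (lam0 : ℂ)) :=
    (Complex.continuous_ofReal.tendsto _).comp hlam_lim
  have hg := aux_step_lim (-β + Complex.I * u) (by simpa using hβ) γ hγ_pos hγ_top y hy
  have hne : (bm - lam0 * (-β + Complex.I * u) * σ0 : ℂ) ≠ 0 := by
    intro h
    have := congrArg Complex.re h
    simp at this
    nlinarith
  have hfin := (hlc.mul hg).div (hden u) hne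
  suffices hS : Complex.ofReal (∑ j, y j) * (∫ t in Set.Ioi (0:ℝ),
          Complex.exp (Complex.I * u * t) *
            Complex.ofReal ((1 / σ0) * Real.exp (-(bm / (σ0 * lam0) + β) * t))) =
      lam0 * ((∑ j, y j : ℝ) : ℂ) / (bm - lam0 * (-β + Complex.I * u) * σ0) by
    rw [hS]; exact hfin
  have hcpos : 0 < bm / (σ0 * lam0) + β := by
    have : bm / (σ0 * lam0) + β = (bm + β * σ0 * lam0) / (σ0 * lam0) := by field_simp
    rw [this]; positivity
  have hI := integral_exp_mul_complex_Ioi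
    (a := Complex.I * u - ((bm / (σ0 * lam0) + β : ℝ) : ℂ)) (by
      rw [Complex.sub_re, Complex.ofReal_re]; simp only [Complex.mul_re, Complex.I_re,
        Complex.I_im, Complex.ofReal_im, Complex.ofReal_re]; linarith) 0
  have e3 : (∫ t in Set.Ioi (0:ℝ), Complex.exp (Complex.I * u * t) *
      Complex.ofReal ((1 / σ0) * Real.exp (-(bm / (σ0 * lam0) + β) * t))) =
      (1 / σ0 : ℂ) * ∫ x : ℝ in Set.Ioi 0,
        Complex.exp ((Complex.I * u - ((bm / (σ0 * lam0) + β : ℝ) : ℂ)) * x) := by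
    rw [← integral_const_mul]
    congr 1; ext t
    rw [Complex.ofReal_mul, Complex.ofReal_exp, mul_left_comm, ← Complex.exp_add]
    congr 2
    · push_cast; rfl
    · push_cast; ring
  rw [e3, hI]
  have hl' : (lam0 : ℂ) ≠ 0 := by exact_mod_cast hlam0.ne'
  have hs' : (σ0 : ℂ) ≠ 0 := by exact_mod_cast hσ0.ne'
  have e4 : Complex.I * u - ((bm / (σ0 * lam0) + β : ℝ) : ℂ) =
      -(bm - lam0 * (-β + Complex.I * u) * σ0 : ℂ) / (σ0 * lam0) := by
    push_cast; field_simp; ring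
  rw [e4, Complex.ofReal_zero, mul_zero, Complex.exp_zero]
  field_simp
end

section
/- There exist constants T₀ > 0 and an integer n₀ ≥ 1 such that for every n ≥ n₀ and every u ∈ ℝ with 0 < |u| < 1/T₀, |∫₀^∞ sin(ut) Λ̄_β⁽ⁿ⁾(t) dt| ≥ (3/16) σ |u|. -/
open MeasureTheory Filter Set

theorem tail_moment (μ : Measure ℝ) [IsProbabilityMeasure μ] (h0 : μ (Set.Iio 0) = 0)
    (h2 : Integrable (fun t => t ^ 2) μ) :
    IntegrableOn (fun t => t * (μ (Set.Ioi t)).toReal) (Set.Ioi 0) ∧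
      ∫ t in Set.Ioi (0:ℝ), t * (μ (Set.Ioi t)).toReal = (1/2) * ∫ t, t ^ 2 ∂μ := by
  have hpos : 0 ≤ᵐ[μ] (fun t : ℝ => t) := by
    rw [Filter.EventuallyLE, ae_iff]
    simpa [Set.Iio] using h0
  have key := lintegral_rpow_eq_lintegral_meas_lt_mul μ hpos aemeasurable_id (p := 2) (by norm_num)
  have hanti : Antitone (fun t : ℝ => (μ (Set.Ioi t)).toReal) := by
    intro a b hab
    exact ENNReal.toReal_mono (measure_ne_top _ _) (measure_mono (Set.Ioi_subset_Ioi hab))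
  have hmeas : Measurable (fun t : ℝ => t * (μ (Set.Ioi t)).toReal) :=
    measurable_id.mul hanti.measurable
  have hl : ∫⁻ t in Set.Ioi (0:ℝ), μ {a : ℝ | t < a} * ENNReal.ofReal (t ^ ((2:ℝ) - 1))
      = ∫⁻ t in Set.Ioi (0:ℝ), ENNReal.ofReal (t * (μ (Set.Ioi t)).toReal) := by
    refine setLIntegral_congr_fun measurableSet_Ioi ?_
    intro t ht
    have ht' : (0:ℝ) < t := ht
    simp only
    rw [ENNReal.ofReal_mul ht'.le, ENNReal.ofReal_toReal (measure_ne_top _ _), mul_comm]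
    norm_num
    rfl
  rw [hl] at key
  have hr : ∫⁻ t, ENNReal.ofReal (t ^ (2:ℝ)) ∂μ = ENNReal.ofReal (∫ t, t ^ 2 ∂μ) := by
    rw [ofReal_integral_eq_lintegral_ofReal h2 (Eventually.of_forall fun t => sq_nonneg t)]
    simp
  rw [hr] at key
  have hnn : 0 ≤ᵐ[volume.restrict (Set.Ioi (0:ℝ))] (fun t : ℝ => t * (μ (Set.Ioi t)).toReal) := by
    filter_upwards [ae_restrict_mem measurableSet_Ioi] with t ht
    exact mul_nonneg (le_of_lt ht) ENNReal.toReal_nonneg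
  have hfin : ∫⁻ t in Set.Ioi (0:ℝ), ENNReal.ofReal (t * (μ (Set.Ioi t)).toReal) ≠ ⊤ := by
    intro h
    rw [h] at key
    simp at key
  have hI : 0 ≤ ∫ t, t ^ 2 ∂μ := integral_nonneg fun t => sq_nonneg t
  constructor
  · refine ⟨hmeas.aestronglyMeasurable, ?_⟩
    rw [hasFiniteIntegral_iff_ofReal hnn]
    exact lt_top_iff_ne_top.2 hfin
  · rw [integral_eq_lintegral_of_nonneg_ae hnn hmeas.aestronglyMeasurable]
    have := congrArg ENNReal.toReal key
    rw [ENNReal.toReal_mul, ENNReal.toReal_ofReal hI, ENNReal.toReal_ofReal (by norm_num)] at this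
    linarith

theorem core_bound (B F : ℝ → ℝ) (β g T δ s u : ℝ) (hβ : 0 ≤ β) (hg : 0 < g) (hT : 0 < T)
    (hu : 0 < u) (huT : u * T < 1) (hBm : Measurable B) (hB : ∀ t, 0 ≤ B t)
    (hBF : ∀ t, 0 ≤ t → B t ≤ F t)
    (hBi : IntegrableOn (fun t => t * B t) (Set.Ioi 0))
    (hFi : IntegrableOn (fun t => t * F t) (Set.Ioi 0))
    (hFT : ∫ t in Set.Ioi T, t * F t ≤ δ)
    (hexp : 2/3 ≤ Real.exp (-(β * T) / g))
    (hs : s ≤ ∫ t in Set.Ioi (0:ℝ), t * B t) :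
    u * (s / 2 - 2 * δ) ≤ ∫ t in Set.Ioi (0:ℝ), Real.sin (u * t) * (Real.exp (-(β * t) / g) * B t) := by
  have hsub : Set.Ioi T ⊆ Set.Ioi (0:ℝ) := Set.Ioi_subset_Ioi hT.le
  have hind : IntegrableOn ((Set.Ioi T).indicator (fun t => t * F t)) (Set.Ioi 0) :=
    hFi.indicator measurableSet_Ioi
  have hindI : ∫ t in Set.Ioi (0:ℝ), (Set.Ioi T).indicator (fun t => t * F t) t
      = ∫ t in Set.Ioi T, t * F t := by
    rw [setIntegral_indicator measurableSet_Ioi, Set.inter_eq_self_of_subset_right hsub]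
  have hE : ∀ t, 0 ≤ t → Real.exp (-(β * t) / g) ≤ 1 := by
    intro t ht
    rw [Real.exp_le_one_iff]
    exact div_nonpos_of_nonpos_of_nonneg (by nlinarith [mul_nonneg hβ ht]) hg.le
  have habs : ∀ t, 0 ≤ t → |Real.sin (u * t) * (Real.exp (-(β * t) / g) * B t)| ≤ u * (t * B t) := by
    intro t ht
    rw [abs_mul, abs_of_nonneg (mul_nonneg (Real.exp_nonneg _) (hB t))]
    have h1 : |Real.sin (u * t)| ≤ u * t := by
      have := Real.abs_sin_le_abs (x := u * t)
      rwa [abs_of_nonneg (mul_nonneg hu.le ht)] at this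
    have h2 : Real.exp (-(β * t) / g) * B t ≤ B t :=
      mul_le_of_le_one_left (hB t) (hE t ht)
    calc _ ≤ (u * t) * B t := mul_le_mul h1 h2 (mul_nonneg (Real.exp_nonneg _) (hB t)) (mul_nonneg hu.le ht)
      _ = _ := by ring
  have hint : IntegrableOn (fun t => Real.sin (u * t) * (Real.exp (-(β * t) / g) * B t)) (Set.Ioi 0) := by
    refine Integrable.mono' (hBi.const_mul u) ?_ ?_
    · exact Measurable.aestronglyMeasurable (by fun_prop)
    · filter_upwards [ae_restrict_mem measurableSet_Ioi] with t ht
      exact habs t (le_of_lt ht)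
  have hL : IntegrableOn (fun t => u * ((1/2) * (t * B t) - 2 * (Set.Ioi T).indicator (fun t => t * F t) t)) (Set.Ioi 0) :=
    ((hBi.const_mul (1/2)).sub (hind.const_mul 2)).const_mul u
  have hLI : ∫ t in Set.Ioi (0:ℝ), u * ((1/2) * (t * B t) - 2 * (Set.Ioi T).indicator (fun t => t * F t) t)
      = u * ((1/2) * (∫ t in Set.Ioi (0:ℝ), t * B t) - 2 * ∫ t in Set.Ioi T, t * F t) := by
    rw [integral_const_mul, integral_sub (hBi.const_mul (1/2)) (hind.const_mul 2),
      integral_const_mul, integral_const_mul, hindI]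
  have hmono := setIntegral_mono_on hL hint measurableSet_Ioi (fun t ht => by
    have ht' : (0:ℝ) < t := ht
    by_cases h : T < t
    · rw [Set.indicator_of_mem (show t ∈ Set.Ioi T from h)]
      have h1 := (abs_le.1 (habs t ht'.le)).1
      have h2 : t * B t ≤ t * F t := mul_le_mul_of_nonneg_left (hBF t ht'.le) ht'.le
      have h3 : 0 ≤ t * B t := mul_nonneg ht'.le (hB t)
      have h4 : u * ((1/2) * (t * B t) - 2 * (t * F t)) ≤ u * (-(t * B t)) :=
        mul_le_mul_of_nonneg_left (by linarith) hu.le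
      linarith
    · rw [Set.indicator_of_notMem (show t ∉ Set.Ioi T from h)]
      push Not at h
      have hx0 : 0 < u * t := mul_pos hu ht'
      have hx1 : u * t ≤ 1 := (mul_le_mul_of_nonneg_left h hu.le).trans huT.le
      have h1 : (3/4) * (u * t) ≤ Real.sin (u * t) := by
        have := Real.sin_gt_sub_cube hx0
        nlinarith [mul_nonneg hx0.le (by nlinarith : 0 ≤ 1 - (u*t)^2)]
      have h2 : 2/3 ≤ Real.exp (-(β * t) / g) := by
        refine hexp.trans (Real.exp_le_exp.2 ?_)
        gcongr
      calc u * ((1/2) * (t * B t) - 2 * 0) = ((3/4) * (u * t)) * ((2/3) * B t) := by ring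
        _ ≤ _ := mul_le_mul h1 (mul_le_mul_of_nonneg_right h2 (hB t))
          (mul_nonneg (by norm_num) (hB t)) (le_trans (by positivity) h1))
  rw [hLI] at hmono
  refine le_trans (mul_le_mul_of_nonneg_left ?_ hu.le) hmono
  linarith

theorem stmt12
    (β α : ℝ) (hβ : 0 ≤ β) (hα : α ∈ Set.Ioo (1:ℝ) 2)
    (Λ : ℕ → Measure ℝ) (hΛprob : ∀ n, IsProbabilityMeasure (Λ n))
    (hΛsupp : ∀ n, Λ n (Set.Iio 0) = 0)
    (lam m γ : ℕ → ℝ)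
    (hlam_pos : ∀ n, 0 < lam n) (hm_pos : ∀ n, 0 < m n) (hγ_pos : ∀ n, 0 < γ n)
    (hγ_top : Tendsto γ atTop atTop)
    (Λbar : ℕ → ℝ → ℝ) (hΛbar : ∀ n t, Λbar n t = (Λ n (Set.Ioi t)).toReal)
    (Λbarβ : ℕ → ℝ → ℝ)
    (hΛbarβ : ∀ n t, Λbarβ n t = Real.exp (-(β * t) / γ n) * Λbar n t)
    (ηβ : ℕ → ℝ) (hηβ : ∀ n, ηβ n = ∫ t in Set.Ioi (0:ℝ), Λbarβ n t)
    (lam0 η0 σ0 bm : ℝ) (hlam0 : 0 < lam0) (hη0 : 0 < η0) (hσ0 : 0 < σ0)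
    (hbm_pos : 0 < bm + β * σ0 * lam0)
    (hmom1 : ∀ n, Integrable (fun t => t) (Λ n))
    (hmom2 : ∀ n, Integrable (fun t => t ^ 2) (Λ n))
    (hlam_lim : Tendsto lam atTop (nhds lam0))
    (hm_lim : Tendsto m atTop (nhds 1))
    (hmean_lim : Tendsto (fun n => ∫ t, t ∂(Λ n)) atTop (nhds η0))
    (hsec_lim : Tendsto (fun n => (1/2) * ∫ t, t ^ 2 ∂(Λ n)) atTop (nhds σ0))
    (hγ_lim : Tendsto (fun n => γ n * (1 - lam n * m n * ∫ t, t ∂(Λ n))) atTop (nhds bm))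
    (C₀ : ℝ) (hC₀ : 0 < C₀)
    (Λstar : Measure ℝ) (hstar_prob : IsProbabilityMeasure Λstar)
    (hstar_supp : Λstar (Set.Iio 0) = 0)
    (hstar_mom : Integrable (fun t => t ^ (2 * α)) Λstar)
    (hdom : ∀ n, ∀ t : ℝ, 0 ≤ t → Λbar n t ≤ C₀ * (Λstar (Set.Ioi t)).toReal)
 :
    ∃ T₀ : ℝ, 0 < T₀ ∧ ∃ n₀ : ℕ, 1 ≤ n₀ ∧ ∀ n : ℕ, n₀ ≤ n → ∀ u : ℝ,
      0 < |u| → |u| < 1 / T₀ →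
        (3 / 16) * σ0 * |u| ≤ |∫ t in Set.Ioi (0:ℝ), Real.sin (u * t) * Λbarβ n t| := by
  have hstar2 : Integrable (fun t : ℝ => t ^ 2) Λstar := by
    have hpos : ∀ᵐ t ∂Λstar, (0:ℝ) ≤ t := by
      rw [ae_iff]
      simpa [Set.Iio] using hstar_supp
    refine Integrable.mono' ((integrable_const (1:ℝ)).add hstar_mom)
      (by fun_prop) ?_
    filter_upwards [hpos] with t ht
    rw [Real.norm_of_nonneg (sq_nonneg t)]
    simp only [Pi.add_apply]
    have h0 : 0 ≤ t ^ (2 * α) := Real.rpow_nonneg ht _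
    rcases le_total t 1 with h | h
    · nlinarith
    · have : t ^ (2:ℝ) ≤ t ^ (2 * α) :=
        Real.rpow_le_rpow_of_exponent_le h (by linarith [hα.1])
      rw [Real.rpow_two] at this
      linarith
  have hFi : IntegrableOn (fun t => t * (C₀ * (Λstar (Set.Ioi t)).toReal)) (Set.Ioi 0) := by
    refine ((tail_moment Λstar hstar_supp hstar2).1.const_mul C₀).congr ?_
    exact Eventually.of_forall fun t => by ring
  have htail : Tendsto (fun k : ℕ => ∫ t in Set.Ioi (k:ℝ), t * (C₀ * (Λstar (Set.Ioi t)).toReal))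
      atTop (nhds 0) := by
    have h := tendsto_setIntegral_of_antitone (μ := volume) (s := fun k : ℕ => Set.Ioi (k:ℝ))
      (f := fun t => t * (C₀ * (Λstar (Set.Ioi t)).toReal))
      (fun k => measurableSet_Ioi)
      (fun a b hab => Set.Ioi_subset_Ioi (by exact_mod_cast hab)) ⟨0, by simpa using hFi⟩
    have he : (⋂ k : ℕ, Set.Ioi (k:ℝ)) = ∅ := by
      ext x
      simp only [Set.mem_iInter, Set.mem_Ioi, Set.mem_empty_iff_false, iff_false, not_forall, not_lt]
      exact exists_nat_ge x
    rw [he] at h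
    simpa using h
  obtain ⟨k, hk, hk1⟩ := ((htail.eventually_le_const (u := 3/32 * σ0) (by positivity)).and
    (eventually_ge_atTop 1)).exists
  have hT : (0:ℝ) < k := by exact_mod_cast hk1
  have hexpl : Tendsto (fun n => Real.exp (-(β * k) / γ n)) atTop (nhds 1) := by
    have := (Real.continuous_exp.tendsto 0).comp (hγ_top.const_div_atTop (-(β * k)))
    simpa [Function.comp_def] using this
  obtain ⟨N, hN⟩ := eventually_atTop.1
    ((hexpl.eventually_const_le (u := 2/3) (by norm_num)).and
      (hsec_lim.eventually_const_le (u := 3/4 * σ0) (by linarith)))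
  have main : ∀ n, N ≤ n → ∀ u : ℝ, 0 < u → u < 1 / (k:ℝ) →
      (3 / 16) * σ0 * u ≤ ∫ t in Set.Ioi (0:ℝ), Real.sin (u * t) * Λbarβ n t := by
    intro n hn u hu huk
    obtain ⟨h1, h2⟩ := hN n hn
    haveI := hΛprob n
    obtain ⟨hi, he⟩ := tail_moment (Λ n) (hΛsupp n) (hmom2 n)
    have hfun : Λbar n = fun t => (Λ n (Set.Ioi t)).toReal := funext (hΛbar n)
    have hanti : Antitone (Λbar n) := by
      rw [hfun]
      intro a b hab
      exact ENNReal.toReal_mono (measure_ne_top _ _) (measure_mono (Set.Ioi_subset_Ioi hab))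
    have hc := core_bound (Λbar n) (fun t => C₀ * (Λstar (Set.Ioi t)).toReal) β (γ n) k
      (3/32 * σ0) (3/4 * σ0) u hβ (hγ_pos n) hT hu ((lt_div_iff₀ hT).1 huk) hanti.measurable
      (fun t => by rw [hΛbar]; exact ENNReal.toReal_nonneg) (hdom n)
      (by simpa only [hΛbar] using hi) hFi hk h1 (by simp only [hΛbar]; rw [he]; exact h2)
    simp only [hΛbarβ]
    refine le_trans (le_of_eq ?_) hc
    ring
  refine ⟨k, hT, max N 1, le_max_right _ _, fun n hn u hu huk => ?_⟩
  have hn' : N ≤ n := (le_max_left _ _).trans hn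
  have hm := main n hn' |u| hu huk
  rcases abs_cases u with ⟨h, _⟩ | ⟨h, _⟩
  · rw [h] at hm ⊢
    exact hm.trans (le_abs_self _)
  · rw [h] at hm ⊢
    simp only [neg_mul, Real.sin_neg, integral_neg] at hm
    exact hm.trans (neg_le_abs _)
end

section
/- For every real κ ≥ 1, lim_{n→∞} ∫₀^∞ |R_β⁽ⁿ⁾(γₙ t) − (1/(σλ)) exp(−((b+m)/(σλ) + β) t)|^{2κ} dt = 0. -/
open MeasureTheory Filter Set

noncomputable def fIter (f : ℝ → ℝ) : ℕ → ℝ → ℝ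
  | 0 => f
  | (k + 1) => fun t => ∫ s, f s * fIter f k (t - s)

structure Ker (f : ℝ → ℝ) (B δ : ℝ) : Prop where
  meas : Measurable f
  nn : ∀ t, 0 ≤ f t
  neg : ∀ t, t < 0 → f t = 0
  le : ∀ t, f t ≤ B
  int : Integrable f
  tot : ∫ t, f t = 1 - δ
  pos : 0 < δ

structure Ren (f R : ℝ → ℝ) (B δ : ℝ) : Prop extends Ker f B δ where
  Rmeas : Measurable R
  Rnn : ∀ t, 0 ≤ R t
  Rneg : ∀ t, t < 0 → R t = 0
  Rbdd : ∃ S, ∀ t, R t ≤ S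
  Rint : Integrable R
  eqn : ∀ t, R t = f t + ∫ s, f s * R (t - s)

section iter
variable {f : ℝ → ℝ} {B δ : ℝ}

lemma Ker.q_nn (h : Ker f B δ) : 0 ≤ 1 - δ := h.tot ▸ integral_nonneg h.nn
lemma Ker.q_lt (h : Ker f B δ) : 1 - δ < 1 := by linarith [h.pos]
lemma Ker.B_nn (h : Ker f B δ) : 0 ≤ B := (h.nn 0).trans (h.le 0)

lemma fIter_meas (h : Ker f B δ) (k : ℕ) : Measurable (fIter f k) := by
  induction k with
  | zero => exact h.meas
  | succ k ih =>
    have : StronglyMeasurable (fun p : ℝ × ℝ => f p.2 * fIter f k (p.1 - p.2)) := by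
      apply Measurable.stronglyMeasurable
      exact (h.meas.comp measurable_snd).mul (ih.comp (measurable_fst.sub measurable_snd))
    exact (this.integral_prod_right').measurable

lemma fIter_nn (h : Ker f B δ) (k : ℕ) (t : ℝ) : 0 ≤ fIter f k t := by
  induction k generalizing t with
  | zero => exact h.nn t
  | succ k ih => exact integral_nonneg fun s => mul_nonneg (h.nn s) (ih _)

lemma fIter_neg (h : Ker f B δ) (k : ℕ) (t : ℝ) (ht : t < 0) : fIter f k t = 0 := by
  induction k generalizing t with
  | zero => exact h.neg t ht
  | succ k ih =>
    simp only [fIter]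
    rw [← integral_zero ℝ ℝ (μ := volume)]
    congr 1; ext s
    by_cases hs : s < 0
    · simp [h.neg s hs]
    · rw [ih _ (by linarith), mul_zero]

lemma mul_shift_int {f g : ℝ → ℝ} (hf : Integrable f) (hg : Measurable g) (S : ℝ)
    (hS : ∀ t, |g t| ≤ S) (t : ℝ) : Integrable (fun s => f s * g (t - s)) := by
  refine hf.mul_bdd (c := S) ?_ ?_
  · exact (hg.comp (measurable_const.sub measurable_id)).aestronglyMeasurable
  · exact Eventually.of_forall fun s => by simpa using hS _

lemma fIter_le (h : Ker f B δ) (k : ℕ) (t : ℝ) : fIter f k t ≤ B * (1 - δ) ^ k := by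
  induction k generalizing t with
  | zero => simpa [fIter] using h.le t
  | succ k ih =>
    have : fIter f (k+1) t ≤ ∫ s, f s * (B * (1 - δ) ^ k) := by
      apply integral_mono
      · exact mul_shift_int h.int (fIter_meas h k) _ (fun t => by
          rw [abs_of_nonneg (fIter_nn h k t)]; exact ih t) t
      · exact h.int.mul_const _
      · intro s; exact mul_le_mul_of_nonneg_left (ih _) (h.nn s)
    rw [integral_mul_const, h.tot] at this
    rw [pow_succ]; linarith

lemma fIter_int (h : Ker f B δ) (k : ℕ) :
    Integrable (fIter f k) ∧ ∫ t, fIter f k t = (1 - δ) ^ (k+1) := by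
  induction k with
  | zero => simpa using ⟨h.int, h.tot⟩
  | succ k ih =>
    have e : fIter f (k+1) = (MeasureTheory.convolution f (fIter f k)
      (ContinuousLinearMap.mul ℝ ℝ) volume) := by
      ext t; simp [fIter, MeasureTheory.convolution]
    refine ⟨e ▸ h.int.integrable_convolution _ ih.1, ?_⟩
    rw [e, integral_convolution _ h.int ih.1, h.tot, ih.2]
    simp; ring

lemma fIter_summable (h : Ker f B δ) (t : ℝ) : Summable (fun k => fIter f k t) := by
  refine Summable.of_nonneg_of_le (fun k => fIter_nn h k t) (fun k => fIter_le h k t) ?_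
  exact (summable_geometric_of_lt_one h.q_nn h.q_lt).mul_left _

lemma ren_exists (h : Ker f B δ) : Ren f (fun t => ∑' k, fIter f k t) B δ := by
  have hsum := fIter_summable h
  have hgeo := summable_geometric_of_lt_one h.q_nn h.q_lt
  have hm : Measurable (fun t => ∑' k, fIter f k t) := by
    apply measurable_of_tendsto_metrizable (f := fun N t => ∑ k ∈ Finset.range N, fIter f k t)
    · intro N; exact Finset.measurable_fun_sum _ fun k _ => fIter_meas h k
    · rw [tendsto_pi_nhds]; intro t; exact (hsum t).hasSum.tendsto_sum_nat
  refine { h with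
    Rmeas := hm
    Rnn := fun t => tsum_nonneg fun k => fIter_nn h k t
    Rneg := ?_, Rbdd := ?_, Rint := ?_, eqn := ?_ }
  · intro t ht; simp [fIter_neg h _ t ht]
  · refine ⟨∑' k, B * (1-δ)^k, fun t => ?_⟩
    exact (hsum t).tsum_le_tsum (fun k => fIter_le h k t) (hgeo.mul_left _)
  · have hs2 : Summable (fun k => ∫ t, ‖fIter f k t‖) := by
      have : ∀ k, ∫ t, ‖fIter f k t‖ = (1-δ)^(k+1) := fun k => by
        rw [← (fIter_int h k).2]; congr 1; ext t; simp [abs_of_nonneg (fIter_nn h k t)]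
      simp_rw [this, pow_succ]; exact hgeo.mul_right _
    refine ⟨hm.aestronglyMeasurable, ?_⟩
    rw [hasFiniteIntegral_iff_ofReal (Eventually.of_forall fun t => tsum_nonneg fun k => fIter_nn h k t)]
    have : ∀ t, ENNReal.ofReal (∑' k, fIter f k t) = ∑' k, ENNReal.ofReal (fIter f k t) :=
      fun t => ENNReal.ofReal_tsum_of_nonneg (fun k => fIter_nn h k t) (hsum t)
    simp_rw [this]
    rw [lintegral_tsum (fun k => (fIter_meas h k).ennreal_ofReal.aemeasurable)]
    have : ∀ k, ∫⁻ t, ENNReal.ofReal (fIter f k t) = ENNReal.ofReal ((1-δ)^(k+1)) := fun k => by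
      rw [← (fIter_int h k).2, ofReal_integral_eq_lintegral_ofReal (fIter_int h k).1
        (Eventually.of_forall (fIter_nn h k))]
    simp_rw [this]
    rw [← ENNReal.ofReal_tsum_of_nonneg (fun k => pow_nonneg h.q_nn _)]
    · exact ENNReal.ofReal_lt_top
    · simp_rw [pow_succ]; exact hgeo.mul_right _
  · intro t
    rw [(hsum t).tsum_eq_zero_add]
    congr 1
    simp only [fIter]
    have hi : ∀ k, Integrable (fun s => f s * fIter f k (t - s)) := fun k =>
      mul_shift_int h.int (fIter_meas h k) _ (fun t => by
          rw [abs_of_nonneg (fIter_nn h k t)]; exact fIter_le h k t) t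
    rw [integral_tsum_of_summable_integral_norm hi]
    · congr 1; ext s; rw [tsum_mul_left]
    · have : ∀ k, ∫ s, ‖f s * fIter f k (t - s)‖ = fIter f (k+1) t := fun k => by
        simp only [fIter]; congr 1; ext s
        rw [Real.norm_of_nonneg (mul_nonneg (h.nn s) (fIter_nn h k _))]
      simp_rw [this]
      exact (summable_nat_add_iff 1).2 (hsum t)

lemma fIter_eq_convIter {g : ℝ → ℝ} {a : ℝ} (hg : ∀ t, 0 ≤ t → f t = a * g t)
    (hneg : ∀ t, t < 0 → f t = 0)
    (hneg' : ∀ k t, t < 0 → fIter f k t = 0) (k : ℕ) (t : ℝ) (ht : 0 ≤ t) :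
    fIter f k t = a ^ (k+1) * convIter g k t := by
  induction k generalizing t with
  | zero => simpa [fIter, convIter] using hg t ht
  | succ k ih =>
    simp only [fIter, convIter]
    rw [← intervalIntegral.integral_const_mul, intervalIntegral.integral_of_le ht,
      ← integral_Icc_eq_integral_Ioc, ← integral_indicator measurableSet_Icc]
    congr 1; ext s
    by_cases hs : s ∈ Icc 0 t
    · rw [indicator_of_mem hs, ih _ (by linarith [hs.2]), hg s hs.1]; ring
    · rw [indicator_of_notMem hs]
      by_cases h0 : s < 0
      · simp [hneg s h0]
      · have : t - s < 0 := by
          by_contra hh; exact hs ⟨by linarith, by linarith⟩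
        rw [hneg' k _ this, mul_zero]

lemma resolvent_eq {g : ℝ → ℝ} {a : ℝ} (h : Ker f B δ) (hg : ∀ t, 0 ≤ t → f t = a * g t)
    (t : ℝ) (ht : 0 ≤ t) : (∑' k, fIter f k t) = resolventFn a g t := by
  unfold resolventFn
  congr 1; ext k
  exact fIter_eq_convIter hg h.neg (fIter_neg h) k t ht
end iter

noncomputable def Fc (f : ℝ → ℝ) (x : ℝ) : ℝ := ∫ s in Iic x, f s
noncomputable def Gc (f : ℝ → ℝ) (x : ℝ) : ℝ := (Ici (0:ℝ)).indicator (fun x => 1 - Fc f x) x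
noncomputable def Hc (f : ℝ → ℝ) (δ x : ℝ) : ℝ := (Ici (0:ℝ)).indicator (fun x => 1 - δ - Fc f x) x
noncomputable def D2 (R : ℝ → ℝ) (s : ℝ) : ℝ := ∫ t, (R t - R (t - s)) ^ 2

section core
variable {f R : ℝ → ℝ} {B δ : ℝ}

lemma Fc_mono (h : Ker f B δ) : Monotone (Fc f) := by
  intro x y hxy
  exact setIntegral_mono_set h.int.integrableOn (Eventually.of_forall h.nn)
    (Eventually.of_forall (Iic_subset_Iic.2 hxy))

lemma Fc_meas (h : Ker f B δ) : Measurable (Fc f) := (Fc_mono h).measurable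

lemma Fc_nn (h : Ker f B δ) (x : ℝ) : 0 ≤ Fc f x := integral_nonneg h.nn

lemma Fc_le (h : Ker f B δ) (x : ℝ) : Fc f x ≤ 1 - δ := by
  rw [← h.tot]; exact setIntegral_le_integral h.int (Eventually.of_forall h.nn)

lemma Fc_neg (h : Ker f B δ) (x : ℝ) (hx : x < 0) : Fc f x = 0 := by
  unfold Fc
  rw [setIntegral_congr_fun (g := fun _ => (0:ℝ)) measurableSet_Iic]
  · simp
  · intro y hy; exact h.neg y (lt_of_le_of_lt hy hx)

lemma Fc_le_mul (h : Ker f B δ) (x : ℝ) (hx : 0 ≤ x) : Fc f x ≤ B * x := by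
  have : Fc f x ≤ ∫ s, (Icc 0 x).indicator (fun _ => B) s := by
    unfold Fc; rw [← integral_indicator measurableSet_Iic]
    apply integral_mono (h.int.indicator measurableSet_Iic)
    · exact (integrable_indicator_iff measurableSet_Icc).2 (by simp)
    · intro s
      by_cases hs : s ∈ Icc 0 x
      · simp only [indicator_of_mem hs]; rw [indicator_of_mem (by exact hs.2)]; exact h.le s
      · simp only [indicator_of_notMem hs]
        by_cases h0 : s < 0
        · simp [indicator, h.neg s h0]
        · rw [indicator_of_notMem]; intro h2; exact hs ⟨by linarith, h2⟩
  rw [integral_indicator measurableSet_Icc] at this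
  simpa [hx, mul_comm] using this

/-- basic Fubini identity -/
lemma Fc_conv (h : Ren f R B δ) (t : ℝ) :
    ∫ x in Iic t, ∫ s, f s * R (x - s) = ∫ s, Fc f s * R (t - s) := by
  have e1 : ∀ x, ∫ s, f s * R (x - s) = ∫ s, R s * f (x - s) := fun x => by
    rw [← integral_sub_left_eq_self _ volume x]; congr 1; ext s; simp [mul_comm]
  simp_rw [e1]
  have hi : Integrable (fun p : ℝ × ℝ => R p.2 * f (p.1 - p.2)) (volume.prod volume) := by
    simpa using h.Rint.convolution_integrand (ContinuousLinearMap.mul ℝ ℝ) h.int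
  have hi' : Integrable (fun p : ℝ × ℝ => R p.2 * f (p.1 - p.2))
      ((volume.restrict (Iic t)).prod volume) := by
    have := hi.restrict (s := Iic t ×ˢ univ)
    rwa [← Measure.prod_restrict, Measure.restrict_univ] at this
  rw [integral_integral_swap (f := fun x s => R s * f (x - s)) hi']
  rw [← integral_sub_left_eq_self _ volume t]
  congr 1; ext s
  rw [integral_const_mul, mul_comm]
  congr 1
  unfold Fc
  rw [← integral_indicator measurableSet_Iic, ← integral_indicator measurableSet_Iic,
    ← integral_sub_right_eq_self ((Iic s).indicator f) (t - s)]
  congr 1; ext x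
  have : x - (t - s) ≤ s ↔ x ≤ t := by constructor <;> intro _ <;> linarith
  simp [indicator, this]

lemma shift_Iic (t : ℝ) : ∫ x in Iic t, R x = ∫ s in Ici 0, R (t - s) := by
  rw [← integral_indicator measurableSet_Iic, ← integral_indicator measurableSet_Ici,
    ← integral_sub_left_eq_self _ volume t]
  congr 1; ext x
  simp [indicator]

lemma R_shift_int (h : Ren f R B δ) (t : ℝ) : Integrable (fun s => R (t - s)) :=
  h.Rint.comp_sub_left t

lemma FR_int (h : Ren f R B δ) (t : ℝ) : Integrable (fun s => Fc f s * R (t - s)) := by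
  refine (R_shift_int h t).bdd_mul (c := 1 - δ) (Fc_meas h.toKer).aestronglyMeasurable ?_
  refine Eventually.of_forall fun x => ?_
  rw [Real.norm_of_nonneg (Fc_nn h.toKer x)]; exact Fc_le h.toKer x

lemma u_eq (h : Ren f R B δ) (t : ℝ) :
    ∫ x in Iic t, R x = Fc f t + ∫ s, Fc f s * R (t - s) := by
  rw [← Fc_conv h]
  unfold Fc
  rw [← integral_add h.int.integrableOn]
  · exact integral_congr_ae (Eventually.of_forall fun x => h.eqn x)
  · have : (fun x => ∫ s, f s * R (x - s)) = fun x => R x - f x := by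
      ext x; rw [h.eqn x]; ring
    rw [this]; exact (h.Rint.sub h.int).integrableOn

lemma HR_eq (h : Ren f R B δ) (t : ℝ) :
    ∫ s, Hc f δ s * R (t - s) = Fc f t - δ * ∫ x in Iic t, R x := by
  have e : ∀ s, Hc f δ s * R (t - s) =
      (1 - δ) * (Ici (0:ℝ)).indicator (fun s => R (t - s)) s - Fc f s * R (t - s) := by
    intro s
    by_cases hs : s ∈ Ici (0:ℝ)
    · simp [Hc, indicator_of_mem hs]; ring
    · simp only [Hc, indicator_of_notMem hs]; rw [Fc_neg h.toKer s (by simpa using hs)]; ring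
  simp_rw [e]
  rw [integral_sub (((R_shift_int h t).indicator measurableSet_Ici).const_mul _) (FR_int h t),
    integral_const_mul, integral_indicator measurableSet_Ici, ← shift_Iic]
  linarith [u_eq h t]

lemma Hc_nn (h : Ker f B δ) (s : ℝ) : 0 ≤ Hc f δ s :=
  indicator_nonneg (fun x _ => by linarith [Fc_le h x]) s

lemma Hc_le (h : Ker f B δ) (s : ℝ) : Hc f δ s ≤ 1 :=
  indicator_apply_le' (fun _ => by linarith [Fc_nn h s, h.pos]) (fun _ => zero_le_one)

lemma Hc_meas (h : Ker f B δ) : Measurable (Hc f δ) :=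
  (measurable_const.sub (Fc_meas h)).indicator measurableSet_Ici

lemma window (h : Ren f R B δ) (s₀ : ℝ) (hs : B * s₀ ≤ 1 / 2) (t : ℝ) :
    ∫ s, (Ico 0 s₀).indicator (fun s => R (t - s)) s ≤ 2 := by
  have hA : Integrable (fun s => (Ici (0:ℝ)).indicator (fun s => R (t - s)) s) :=
    (R_shift_int h t).indicator measurableSet_Ici
  have key : ∫ s, (1/2) * (Ico 0 s₀).indicator (fun s => R (t - s)) s ≤
      ∫ s, ((Ici (0:ℝ)).indicator (fun s => R (t - s)) s - Fc f s * R (t - s)) := by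
    apply integral_mono
    · exact ((R_shift_int h t).indicator measurableSet_Ico).const_mul _
    · exact hA.sub (FR_int h t)
    · intro s
      dsimp only
      have hR := h.Rnn (t - s)
      by_cases h0 : s < 0
      · have : s ∉ Ico 0 s₀ := fun hh => by linarith [hh.1]
        rw [indicator_of_notMem this, indicator_of_notMem (by simpa using h0), Fc_neg h.toKer s h0]; simp
      · push Not at h0
        rw [indicator_of_mem (by exact h0 : s ∈ Ici (0:ℝ))]
        by_cases h1 : s < s₀
        · rw [indicator_of_mem (show s ∈ Ico 0 s₀ from ⟨h0, h1⟩)]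
          have : Fc f s ≤ 1/2 := (Fc_le_mul h.toKer s h0).trans
            ((mul_le_mul_of_nonneg_left h1.le h.toKer.B_nn).trans hs)
          nlinarith
        · rw [indicator_of_notMem (fun hh => h1 hh.2)]
          have := Fc_le h.toKer s
          nlinarith [h.pos]
  rw [integral_const_mul, integral_sub hA (FR_int h t), integral_indicator measurableSet_Ici,
    ← shift_Iic, u_eq h t] at key
  linarith [Fc_le h.toKer t, h.pos]

lemma sup_bound (h : Ren f R B δ) (s₀ c₀ : ℝ) (hs0 : 0 < s₀) (hc0 : 0 < c₀) (hs : B * s₀ ≤ 1 / 2)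
    (hf : ∀ s ∈ Ico 0 s₀, c₀ ≤ f s) (t : ℝ) : R t ≤ 3 * B / (s₀ * c₀) := by
  obtain ⟨S₁, hS₁⟩ := h.Rbdd
  have hbdd : BddAbove (range R) := ⟨S₁, by rintro _ ⟨x, rfl⟩; exact hS₁ x⟩
  set S := ⨆ t, R t with hS
  have hRS : ∀ t, R t ≤ S := fun t => le_ciSup hbdd t
  have hSnn : 0 ≤ S := (h.Rnn 0).trans (hRS 0)
  have key : ∀ t, R t ≤ 3 * B + S * (1 - s₀ * c₀) := by
    intro t
    rw [h.eqn t]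
    have hA : Integrable (fun s => (Ico 0 s₀).indicator (fun s => R (t - s)) s) :=
      (R_shift_int h t).indicator measurableSet_Ico
    have hI : Integrable (fun s => (Ico 0 s₀).indicator (fun _ => c₀) s) :=
      (integrable_indicator_iff measurableSet_Ico).2 (by simp)
    have hJ : Integrable (fun s => f s - (Ico 0 s₀).indicator (fun _ => c₀) s) := h.int.sub hI
    have : ∫ s, f s * R (t - s) ≤ ∫ s, (B * (Ico 0 s₀).indicator (fun s => R (t - s)) s +
        S * (f s - (Ico 0 s₀).indicator (fun _ => c₀) s)) := by
      apply integral_mono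
      · exact mul_shift_int h.int h.Rmeas S (fun t => by
          rw [abs_of_nonneg (h.Rnn t)]; exact hRS t) t
      · exact (hA.const_mul _).add (hJ.const_mul _)
      · intro s
        dsimp only
        have hR := h.Rnn (t - s)
        by_cases h1 : s ∈ Ico 0 s₀
        · rw [indicator_of_mem h1, indicator_of_mem h1]
          have := mul_le_mul_of_nonneg_right (h.le s) hR
          have := mul_nonneg hSnn (sub_nonneg.2 (hf s h1))
          linarith
        · rw [indicator_of_notMem h1, indicator_of_notMem h1]
          have := mul_le_mul_of_nonneg_left (hRS (t - s)) (h.nn s)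
          linarith
    rw [integral_add (hA.const_mul _) (hJ.const_mul _), integral_const_mul,
      integral_const_mul, integral_sub h.int hI, h.tot,
      integral_indicator measurableSet_Ico (f := fun _ => c₀)] at this
    simp only [integral_const, measureReal_restrict_apply_univ, Real.volume_real_Ico, sub_zero,
      smul_eq_mul, max_eq_left hs0.le] at this
    have w := mul_le_mul_of_nonneg_left (window h s₀ hs t) h.toKer.B_nn
    have := mul_nonneg hSnn h.pos.le
    have := h.le t
    linarith
  have hle : S ≤ 3 * B + S * (1 - s₀ * c₀) := ciSup_le key
  refine (hRS t).trans ?_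
  rw [le_div_iff₀ (by positivity)]
  linarith

lemma RR_int (h : Ren f R B δ) {g : ℝ → ℝ} (hg : Integrable g) (S : ℝ) (hS : ∀ t, R t ≤ S) :
    Integrable (fun t => R t * g t) := by
  refine hg.bdd_mul (c := S) h.Rmeas.aestronglyMeasurable (Eventually.of_forall fun t => ?_)
  rw [Real.norm_of_nonneg (h.Rnn t)]; exact hS t

lemma R_shift_int' (h : Ren f R B δ) (s : ℝ) : Integrable (fun t => R (t - s)) :=
  h.Rint.comp_sub_right s

lemma D2_nn (s : ℝ) : 0 ≤ D2 R s := integral_nonneg fun _ => sq_nonneg _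

lemma diff_sq_int (h : Ren f R B δ) (a b : ℝ) : Integrable (fun t => (R (t - a) - R (t - b))^2) := by
  obtain ⟨S, hS⟩ := h.Rbdd
  have hi := ((R_shift_int' h a).sub (R_shift_int' h b))
  have := hi.bdd_mul (c := S) (f := fun t => R (t - a) - R (t - b)) hi.1
    (Eventually.of_forall fun t => by
      rw [Real.norm_eq_abs, abs_le]
      constructor <;> linarith [h.Rnn (t-a), h.Rnn (t-b), hS (t-a), hS (t-b)])
  simpa [sq] using this

lemma D2_eq (h : Ren f R B δ) (s : ℝ) :
    D2 R s = 2 * (∫ t, R t * R t) - 2 * ∫ t, R t * R (t - s) := by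
  obtain ⟨S, hS⟩ := h.Rbdd
  unfold D2
  have i1 := RR_int h h.Rint S hS
  have i2 := RR_int h (R_shift_int' h s) S hS
  have i3 := i1.comp_sub_right s
  have e : ∀ t, (R t - R (t - s))^2 = (R t * R t + R (t - s) * R (t - s)) - 2 * (R t * R (t - s)) :=
    fun t => by ring
  simp_rw [e]
  have i4 : Integrable (fun t => R t * R t + R (t - s) * R (t - s)) := i1.add i3
  rw [integral_sub i4 (i2.const_mul 2), integral_add i1 i3, integral_const_mul,
    integral_sub_right_eq_self (fun t => R t * R t) s]
  ring

lemma D2_le_norm (h : Ren f R B δ) (s : ℝ) : D2 R s ≤ 2 * ∫ t, R t * R t := by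
  rw [D2_eq h]
  have : 0 ≤ ∫ t, R t * R (t - s) := integral_nonneg fun t => mul_nonneg (h.Rnn _) (h.Rnn _)
  linarith

lemma D2_meas (h : Ren f R B δ) : Measurable (D2 R) := by
  have : StronglyMeasurable (fun p : ℝ × ℝ => (R p.2 - R (p.2 - p.1))^2) := by
    apply Measurable.stronglyMeasurable
    exact ((h.Rmeas.comp measurable_snd).sub
      (h.Rmeas.comp (measurable_snd.sub measurable_fst))).pow_const 2
  exact (this.integral_prod_right').measurable

lemma mul_D2_int (h : Ren f R B δ) {g : ℝ → ℝ} (hg : Integrable g) :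
    Integrable (fun s => g s * D2 R s) := by
  refine hg.mul_bdd (c := 2 * ∫ t, R t * R t) (D2_meas h).aestronglyMeasurable ?_
  refine Eventually.of_forall fun s => ?_
  rw [Real.norm_of_nonneg (D2_nn s)]; exact D2_le_norm h s

lemma energy (h : Ren f R B δ) :
    δ * (∫ t, R t * R t) + (1/2) * ∫ s, f s * D2 R s = ∫ t, R t * f t := by
  obtain ⟨S, hS⟩ := h.Rbdd
  have i1 := RR_int h h.Rint S hS
  have i2 := RR_int h h.int S hS
  have hprod : Integrable (fun p : ℝ × ℝ => R p.1 * (f p.2 * R (p.1 - p.2))) (volume.prod volume) := by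
    have hi : Integrable (fun p : ℝ × ℝ => f p.2 * R (p.1 - p.2)) (volume.prod volume) := by
      simpa using h.int.convolution_integrand (ContinuousLinearMap.mul ℝ ℝ) h.Rint
    refine hi.bdd_mul (c := S) (h.Rmeas.comp measurable_fst).aestronglyMeasurable
      (Eventually.of_forall fun p => ?_)
    rw [Real.norm_of_nonneg (h.Rnn _)]; exact hS _
  have e1 : ∫ t, R t * R t = (∫ t, R t * f t) + ∫ t, ∫ s, R t * (f s * R (t - s)) := by
    have i3 : Integrable (fun t => ∫ s, R t * (f s * R (t - s))) := hprod.integral_prod_left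
    rw [← integral_add i2 i3]
    congr 1; ext t
    rw [integral_const_mul, ← mul_add, ← h.eqn t]
  rw [integral_integral_swap (f := fun t s => R t * (f s * R (t - s))) hprod] at e1
  have e2 : ∀ s, ∫ t, R t * (f s * R (t - s)) = f s * (∫ t, R t * R t) - (1/2) * (f s * D2 R s) := by
    intro s
    rw [D2_eq h]
    have : ∀ t, R t * (f s * R (t - s)) = f s * (R t * R (t - s)) := fun t => by ring
    simp_rw [this]
    rw [integral_const_mul]; ring
  simp_rw [e2] at e1
  rw [integral_sub (h.int.mul_const _) ((mul_D2_int h h.int).const_mul _), integral_mul_const,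
    integral_const_mul, h.tot] at e1
  linarith

lemma energy_le (h : Ren f R B δ) (S : ℝ) (hS : ∀ t, R t ≤ S) :
    δ * (∫ t, R t * R t) ≤ S ∧ ∫ s, f s * D2 R s ≤ 2 * S := by
  have hSnn : 0 ≤ S := (h.Rnn 0).trans (hS 0)
  have e := energy h
  have n1 : 0 ≤ ∫ s, f s * D2 R s := integral_nonneg fun s => mul_nonneg (h.nn s) (D2_nn s)
  have n2 : 0 ≤ ∫ t, R t * R t := integral_nonneg fun s => mul_self_nonneg _
  have n3 : ∫ t, R t * f t ≤ ∫ t, S * f t :=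
    integral_mono (RR_int h h.int S hS) (h.int.const_mul _)
      fun t => mul_le_mul_of_nonneg_right (hS t) (h.nn t)
  rw [integral_const_mul, h.tot] at n3
  have := mul_nonneg hSnn h.pos.le
  have := mul_nonneg h.pos.le n2
  constructor <;> linarith

lemma D2_shift (a b : ℝ) : ∫ t, (R (t - a) - R (t - b))^2 = D2 R (b - a) := by
  unfold D2
  rw [← integral_sub_right_eq_self (fun t => (R t - R (t - (b - a))) ^ 2) a]
  congr 1; ext t
  rw [show t - a - (b - a) = t - b by ring]

lemma D2_tri (h : Ren f R B δ) (a s : ℝ) : D2 R a ≤ 2 * D2 R (a + s) + 2 * D2 R s := by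
  have e1 := D2_shift (R := R) 0 a
  have e2 := D2_shift (R := R) 0 (a + s)
  have e3 := D2_shift (R := R) a (a + s)
  simp only [sub_zero, add_sub_cancel_left] at e1 e2 e3
  have i1 := diff_sq_int h 0 a
  have i2 := diff_sq_int h 0 (a + s)
  have i3 := diff_sq_int h a (a + s)
  simp only [sub_zero] at i1 i2 i3
  rw [← e1, ← e2, ← e3, ← integral_const_mul, ← integral_const_mul,
    ← integral_add (i2.const_mul _) (i3.const_mul _)]
  apply integral_mono i1 ((i2.const_mul _).add (i3.const_mul _))
  intro t
  simp only [Pi.add_apply]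
  nlinarith [sq_nonneg ((R t - R (t - (a+s))) + (R (t - a) - R (t - (a+s))))]

lemma D2_double (h : Ren f R B δ) (a : ℝ) : D2 R (2 * a) ≤ 4 * D2 R a := by
  have e1 := D2_shift (R := R) 0 (2 * a)
  have e2 := D2_shift (R := R) 0 a
  have e3 := D2_shift (R := R) a (2 * a)
  simp only [sub_zero, show 2 * a - a = a by ring] at e1 e2 e3
  have i1 := diff_sq_int h 0 (2 * a)
  have i2 := diff_sq_int h 0 a
  have i3 := diff_sq_int h a (2 * a)
  simp only [sub_zero] at i1 i2 i3
  have : D2 R (2 * a) ≤ 2 * D2 R a + 2 * D2 R a := by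
    nth_rw 2 [← e3]
    rw [← e1, ← e2, ← integral_const_mul, ← integral_const_mul,
      ← integral_add (i2.const_mul _) (i3.const_mul _)]
    apply integral_mono i1 ((i2.const_mul _).add (i3.const_mul _))
    intro t
    simp only [Pi.add_apply]
    nlinarith [sq_nonneg ((R t - R (t - a)) - (R (t - a) - R (t - (2 * a))))]
  linarith

lemma D2_small (h : Ren f R B δ) (S : ℝ) (hS : ∀ t, R t ≤ S) (s₀ c₀ : ℝ) (hs0 : 0 < s₀)
    (hc0 : 0 < c₀) (hf : ∀ s ∈ Ico 0 s₀, c₀ ≤ f s) (a : ℝ) (ha : 0 ≤ a) (ha' : a ≤ s₀ / 2) :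
    D2 R a ≤ 16 * S / (c₀ * s₀) := by
  have hloc : ∀ x y : ℝ, IntervalIntegrable (D2 R) volume x y := fun x y => by
    have : IntegrableOn (D2 R) (uIoc x y) := by
      refine Measure.integrableOn_of_bounded (M := 2 * ∫ t, R t * R t) (by simp)
        (D2_meas h).aestronglyMeasurable (Eventually.of_forall fun s => ?_)
      rw [Real.norm_of_nonneg (D2_nn s)]; exact D2_le_norm h s
    exact intervalIntegrable_iff.2 this
  have hI : c₀ * ∫ s in (0:ℝ)..s₀, D2 R s ≤ 2 * S := by
    refine le_trans ?_ (energy_le h S hS).2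
    rw [intervalIntegral.integral_of_le hs0.le, ← integral_Ico_eq_integral_Ioc,
      ← integral_indicator measurableSet_Ico, ← integral_const_mul]
    apply integral_mono
    · refine Integrable.const_mul ((integrable_indicator_iff measurableSet_Ico).2 ?_) _
      have := (intervalIntegrable_iff_integrableOn_Ico_of_le hs0.le).1 (hloc 0 s₀)
      exact this
    · exact mul_D2_int h h.int
    · intro s
      dsimp only
      by_cases hs : s ∈ Ico 0 s₀
      · rw [indicator_of_mem hs]; exact mul_le_mul_of_nonneg_right (hf s hs) (D2_nn s)
      · rw [indicator_of_notMem hs, mul_zero]; exact mul_nonneg (h.nn s) (D2_nn s)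
  have sub1 : ∫ s in (0:ℝ)..(s₀/2), D2 R s ≤ ∫ s in (0:ℝ)..s₀, D2 R s :=
    intervalIntegral.integral_mono_interval le_rfl (by linarith) (by linarith)
      (Eventually.of_forall fun s => D2_nn s) (hloc _ _)
  have sub2 : ∫ s in a..(a + s₀/2), D2 R s ≤ ∫ s in (0:ℝ)..s₀, D2 R s :=
    intervalIntegral.integral_mono_interval ha (by linarith) (by linarith)
      (Eventually.of_forall fun s => D2_nn s) (hloc _ _)
  have av : ∫ s in (0:ℝ)..(s₀/2), D2 R a ≤ ∫ s in (0:ℝ)..(s₀/2), (2 * D2 R (a + s) + 2 * D2 R s) := by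
    have hl2 : IntervalIntegrable (fun s => D2 R (a + s)) volume 0 (s₀/2) := by
      have := (hloc a (a + s₀/2)).comp_add_left (c := a)
      simpa using this
    apply intervalIntegral.integral_mono_on (by linarith) (by simp)
    · exact (hl2.const_mul 2).add ((hloc _ _).const_mul 2)
    · intro s _; exact D2_tri h a s
  have hl2 : IntervalIntegrable (fun s => D2 R (a + s)) volume 0 (s₀/2) := by
    have := (hloc a (a + s₀/2)).comp_add_left (c := a)
    simpa using this
  rw [intervalIntegral.integral_add (hl2.const_mul 2) ((hloc _ _).const_mul 2),
    intervalIntegral.integral_const_mul, intervalIntegral.integral_const_mul,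
    intervalIntegral.integral_comp_add_left (fun s => D2 R s) a, add_zero,
    intervalIntegral.integral_const, sub_zero, smul_eq_mul] at av
  rw [le_div_iff₀ (by positivity)]
  have : s₀ / 2 * D2 R a ≤ 4 * ∫ s in (0:ℝ)..s₀, D2 R s := by linarith
  nlinarith [mul_le_mul_of_nonneg_left this hc0.le]

lemma D2_pow (h : Ren f R B δ) (S : ℝ) (hS : ∀ t, R t ≤ S) (s₀ c₀ : ℝ) (hs0 : 0 < s₀)
    (hc0 : 0 < c₀) (hf : ∀ s ∈ Ico 0 s₀, c₀ ≤ f s) (k : ℕ) (a : ℝ) (ha : 0 ≤ a)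
    (ha' : a ≤ 2 ^ k * (s₀ / 2)) :
    D2 R a ≤ 4 ^ k * (16 * S / (c₀ * s₀)) := by
  induction k generalizing a with
  | zero => simpa using D2_small h S hS s₀ c₀ hs0 hc0 hf a ha (by simpa using ha')
  | succ k ih =>
    have h1 := D2_double h (a / 2)
    have h2 := ih (a / 2) (by linarith) (by rw [pow_succ] at ha'; linarith)
    rw [show 2 * (a / 2) = a by ring] at h1
    rw [pow_succ]; linarith
end core

section fin
variable {f R : ℝ → ℝ} {B δ : ℝ}

lemma zz_nonneg (z : ℝ → ℝ) (T : ℝ) (hz : IntervalIntegrable z volume 0 T) :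
    0 ≤ ∫ x in (0:ℝ)..T, (∫ s in (0:ℝ)..x, z s) * z x := by
  have ac := hz.absolutelyContinuousOnInterval_intervalIntegral (c := 0) (by simp)
  have e := ac.integral_mul_deriv_eq_deriv_mul ac
  have hd := hz.ae_hasDerivAt_integral
  have e1 : ∫ x in (0:ℝ)..T, (∫ s in (0:ℝ)..x, z s) * deriv (fun x => ∫ s in (0:ℝ)..x, z s) x
      = ∫ x in (0:ℝ)..T, (∫ s in (0:ℝ)..x, z s) * z x := by
    apply intervalIntegral.integral_congr_ae
    filter_upwards [hd] with x hx hx'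
    rw [(hx (uIoc_subset_uIcc hx') 0 (by simp)).deriv]
  have e2 : ∫ x in (0:ℝ)..T, deriv (fun x => ∫ s in (0:ℝ)..x, z s) x * (∫ s in (0:ℝ)..x, z s)
      = ∫ x in (0:ℝ)..T, (∫ s in (0:ℝ)..x, z s) * z x := by
    rw [← e1]; congr 1; ext x; ring
  rw [e1, e2] at e
  simp only [intervalIntegral.integral_same] at e
  nlinarith [mul_self_nonneg (∫ s in (0:ℝ)..T, z s)]

lemma z_bound (z e : ℝ → ℝ) (T μ δ : ℝ) (hT : 0 ≤ T) (hμ : 0 < μ) (hδ : 0 ≤ δ)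
    (hz : IntervalIntegrable z volume 0 T)
    (hz2 : IntervalIntegrable (fun t => z t ^ 2) volume 0 T)
    (he2 : IntervalIntegrable (fun t => e t ^ 2) volume 0 T)
    (heq : ∀ t, 0 ≤ t → μ * z t + δ * (∫ s in (0:ℝ)..t, z s) = e t) :
    μ ^ 2 * ∫ t in (0:ℝ)..T, z t ^ 2 ≤ ∫ t in (0:ℝ)..T, e t ^ 2 := by
  have ac := hz.absolutelyContinuousOnInterval_intervalIntegral (c := 0) (by simp)
  have ivz : IntervalIntegrable (fun x => (∫ s in (0:ℝ)..x, z s) * z x) volume 0 T :=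
    hz.continuousOn_mul ac.continuousOn
  have key : ∫ t in (0:ℝ)..T, (μ ^ 2 * z t ^ 2 + (2 * μ * δ) * ((∫ s in (0:ℝ)..t, z s) * z t)) ≤
      ∫ t in (0:ℝ)..T, e t ^ 2 := by
    apply intervalIntegral.integral_mono_on hT ((hz2.const_mul _).add (ivz.const_mul _)) he2
    intro t ht
    rw [← heq t ht.1]
    nlinarith [sq_nonneg (δ * (∫ s in (0:ℝ)..t, z s))]
  rw [intervalIntegral.integral_add (hz2.const_mul _) (ivz.const_mul _),
    intervalIntegral.integral_const_mul, intervalIntegral.integral_const_mul] at key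
  have := zz_nonneg z T hz
  have : 0 ≤ 2 * μ * δ * ∫ x in (0:ℝ)..T, (∫ s in (0:ℝ)..x, z s) * z x := by positivity
  linarith

lemma cs_weight {H φ : ℝ → ℝ} (hH : ∀ s, 0 ≤ H s) (hHi : Integrable H)
    (h1 : Integrable (fun s => H s * φ s)) (h2 : Integrable (fun s => H s * φ s ^ 2))
    (hμ : 0 < ∫ s, H s) : (∫ s, H s * φ s) ^ 2 ≤ (∫ s, H s) * ∫ s, H s * φ s ^ 2 := by
  set μ := ∫ s, H s
  set c := (∫ s, H s * φ s) / μ with hc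
  have hc' : ∫ s, H s * φ s = c * μ := by rw [hc]; field_simp
  have : 0 ≤ ∫ s, H s * (φ s - c) ^ 2 := integral_nonneg fun s => mul_nonneg (hH s) (sq_nonneg _)
  have e : ∀ s, H s * (φ s - c) ^ 2 = H s * φ s ^ 2 - (2 * c) * (H s * φ s) + c ^ 2 * H s :=
    fun s => by ring
  simp_rw [e] at this
  have i3 : Integrable (fun s => H s * φ s ^ 2 - (2 * c) * (H s * φ s)) := h2.sub (h1.const_mul _)
  rw [integral_add i3 (hHi.const_mul _), integral_sub h2 (h1.const_mul _), integral_const_mul,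
    integral_const_mul, hc'] at this
  rw [hc']
  have : 0 ≤ (∫ s, H s * φ s ^ 2) - c ^ 2 * μ := by
    have h3 : ∫ s, H s = μ := rfl
    rw [h3] at this; linarith
  nlinarith

noncomputable def Er (f R : ℝ → ℝ) (δ μ t : ℝ) : ℝ := μ * R t - ∫ s, Hc f δ s * R (t - s)

lemma Er_bound (h : Ren f R B δ) (hH : Integrable (Hc f δ)) (μ : ℝ) (hμ : ∫ s, Hc f δ s = μ)
    (hμ0 : 0 < μ) : Integrable (fun t => Er f R δ μ t ^ 2) ∧
    ∫ t, Er f R δ μ t ^ 2 ≤ μ * ∫ s, Hc f δ s * D2 R s := by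
  obtain ⟨S, hS⟩ := h.Rbdd
  have hSnn : 0 ≤ S := (h.Rnn 0).trans (hS 0)
  have hRabs : ∀ t, |R t| ≤ S := fun t => by rw [abs_of_nonneg (h.Rnn t)]; exact hS t
  have hHnn := Hc_nn h.toKer
  have hp : Integrable (fun p : ℝ × ℝ => Hc f δ p.2 * (R p.1 - R (p.1 - p.2)) ^ 2)
      (volume.prod volume) := by
    have i1 : Integrable (fun p : ℝ × ℝ => Hc f δ p.2 * R (p.1 - p.2)) (volume.prod volume) := by
      simpa using hH.convolution_integrand (ContinuousLinearMap.mul ℝ ℝ) h.Rint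
    have i2 : Integrable (fun p : ℝ × ℝ => R p.1 * Hc f δ p.2) (volume.prod volume) :=
      h.Rint.mul_prod hH
    refine ((i1.add i2).const_mul S).mono' ?_ (Eventually.of_forall fun p => ?_)
    · apply Measurable.aestronglyMeasurable
      exact ((Hc_meas h.toKer).comp measurable_snd).mul (((h.Rmeas.comp measurable_fst).sub
        (h.Rmeas.comp (measurable_fst.sub measurable_snd))).pow_const 2)
    · rw [Real.norm_of_nonneg (mul_nonneg (hHnn _) (sq_nonneg _))]
      simp only [Pi.add_apply]
      have a := h.Rnn p.1
      have b := h.Rnn (p.1 - p.2)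
      have a' := hS p.1
      have b' := hS (p.1 - p.2)
      have : (R p.1 - R (p.1 - p.2)) ^ 2 ≤ S * (R p.1 + R (p.1 - p.2)) := by nlinarith [mul_nonneg a b]
      nlinarith [mul_le_mul_of_nonneg_left this (hHnn p.2)]
  have hEr : ∀ t, Er f R δ μ t = ∫ s, Hc f δ s * (R t - R (t - s)) := by
    intro t
    simp_rw [mul_sub]
    rw [integral_sub (hH.mul_const _) (mul_shift_int hH h.Rmeas S hRabs t), integral_mul_const, hμ]
    rfl
  have hmeas : Measurable (Er f R δ μ) := by
    have : StronglyMeasurable (fun p : ℝ × ℝ => Hc f δ p.2 * R (p.1 - p.2)) := by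
      apply Measurable.stronglyMeasurable
      exact ((Hc_meas h.toKer).comp measurable_snd).mul
        (h.Rmeas.comp (measurable_fst.sub measurable_snd))
    exact (h.Rmeas.const_mul μ).sub (this.integral_prod_right').measurable
  have hi3 : Integrable (fun t => μ * ∫ s, Hc f δ s * (R t - R (t - s)) ^ 2) :=
    hp.integral_prod_left.const_mul _
  have hle : ∀ t, Er f R δ μ t ^ 2 ≤ μ * ∫ s, Hc f δ s * (R t - R (t - s)) ^ 2 := by
    intro t
    rw [hEr t]
    have hm : Measurable (fun s => R t - R (t - s)) :=
      measurable_const.sub (h.Rmeas.comp (measurable_const.sub measurable_id))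
    have hb : ∀ s, |R t - R (t - s)| ≤ S := fun s => by
      rw [abs_le]; constructor <;> linarith [h.Rnn t, h.Rnn (t-s), hS t, hS (t-s)]
    have := cs_weight (φ := fun s => R t - R (t - s)) hHnn hH
      (hH.mul_bdd (c := S) hm.aestronglyMeasurable (Eventually.of_forall hb))
      (hH.mul_bdd (c := S ^ 2) (hm.pow_const 2).aestronglyMeasurable
        (Eventually.of_forall fun s => by
          rw [Real.norm_of_nonneg (sq_nonneg _), ← sq_abs]
          exact pow_le_pow_left₀ (abs_nonneg _) (hb s) 2)) (hμ ▸ hμ0)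
    rwa [hμ] at this
  have hint : Integrable (fun t => Er f R δ μ t ^ 2) := by
    refine hi3.mono' (hmeas.pow_const 2).aestronglyMeasurable (Eventually.of_forall fun t => ?_)
    rw [Real.norm_of_nonneg (sq_nonneg _)]; exact hle t
  refine ⟨hint, (integral_mono hint hi3 hle).trans (le_of_eq ?_)⟩
  rw [integral_const_mul,
    integral_integral_swap (f := fun t s => Hc f δ s * (R t - R (t - s)) ^ 2) hp]
  simp_rw [integral_const_mul]
  rfl

lemma u_interval (h : Ren f R B δ) (t : ℝ) (ht : 0 ≤ t) : ∫ x in Iic t, R x = ∫ x in (0:ℝ)..t, R x := by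
  rw [intervalIntegral.integral_of_le ht, ← integral_Icc_eq_integral_Ioc,
    ← integral_indicator measurableSet_Iic, ← integral_indicator measurableSet_Icc]
  congr 1; ext x
  by_cases hx : x < 0
  · simp [indicator, h.Rneg x hx]
  · push Not at hx
    simp [indicator, hx]

lemma main_bound (h : Ren f R B δ) (hH : Integrable (Hc f δ)) (μ : ℝ) (hμ : ∫ s, Hc f δ s = μ)
    (hμ0 : 0 < μ) :
    IntegrableOn (fun t => (R t - (1 - δ) / μ * Real.exp (-(δ / μ) * t)) ^ 2) (Ioi 0) ∧
    ∫ t in Ioi 0, (R t - (1 - δ) / μ * Real.exp (-(δ / μ) * t)) ^ 2 ≤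
      2 / μ * (∫ s, Hc f δ s * D2 R s) + 2 / μ := by
  have hδ := h.pos
  have hρ : 0 < δ / μ := by positivity
  obtain ⟨S, hS⟩ := h.Rbdd
  set A := (1 - δ) / μ with hA
  have hAnn : 0 ≤ A := div_nonneg h.toKer.q_nn hμ0.le
  set G : ℝ → ℝ := fun t => A * Real.exp (-(δ / μ) * t) with hG
  set z : ℝ → ℝ := fun t => R t - G t with hz
  have hGi : IntegrableOn G (Ioi 0) :=
    (integrableOn_exp_mul_Ioi (by linarith : -(δ / μ) < 0) 0).const_mul A
  have hGc : Continuous G := by fun_prop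
  have hzi : IntegrableOn z (Ioi 0) := h.Rint.integrableOn.sub hGi
  have hzm : Measurable z := h.Rmeas.sub hGc.measurable
  have hzb : ∀ t ∈ Ioi (0:ℝ), |z t| ≤ S + A := by
    intro t ht
    have : Real.exp (-(δ / μ) * t) ≤ 1 := Real.exp_le_one_iff.2 (by
      have : (0:ℝ) < t := ht
      nlinarith)
    have h1 : G t ≤ A := by simpa [hG] using mul_le_mul_of_nonneg_left this hAnn
    have h2 : 0 ≤ G t := by positivity
    have h3 : z t = R t - G t := rfl
    rw [h3, abs_le]; constructor <;> linarith [h.Rnn t, hS t, h.Rnn 0, hS 0]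
  have hz2 : IntegrableOn (fun t => z t ^ 2) (Ioi 0) := by
    have : IntegrableOn (fun t => z t * z t) (Ioi 0) := by
      refine Integrable.bdd_mul (c := S + A) hzi hzm.aestronglyMeasurable ?_
      exact (ae_restrict_iff' measurableSet_Ioi).2 (Eventually.of_forall hzb)
    simpa [sq] using this
  refine ⟨hz2, ?_⟩
  obtain ⟨hEi, hEb⟩ := Er_bound h hH μ hμ hμ0
  have hH2 : Integrable (fun t => Hc f δ t ^ 2) := by
    refine hH.mono' ((Hc_meas h.toKer).pow_const 2).aestronglyMeasurable
      (Eventually.of_forall fun t => ?_)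
    rw [Real.norm_of_nonneg (sq_nonneg _)]
    nlinarith [Hc_nn h.toKer t, Hc_le h.toKer t]
  have hH2b : ∫ t, Hc f δ t ^ 2 ≤ μ := by
    rw [← hμ]; apply integral_mono hH2 hH
    intro t; dsimp only; nlinarith [Hc_nn h.toKer t, Hc_le h.toKer t]
  have hsum : Integrable (fun t => 2 * Er f R δ μ t ^ 2 + 2 * Hc f δ t ^ 2) :=
    (hEi.const_mul 2).add (hH2.const_mul 2)
  have hEm : AEStronglyMeasurable (fun t => Er f R δ μ t) volume := by
    have : StronglyMeasurable (fun p : ℝ × ℝ => Hc f δ p.2 * R (p.1 - p.2)) := by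
      apply Measurable.stronglyMeasurable
      exact ((Hc_meas h.toKer).comp measurable_snd).mul
        (h.Rmeas.comp (measurable_fst.sub measurable_snd))
    exact ((h.Rmeas.const_mul μ).sub (this.integral_prod_right').measurable).aestronglyMeasurable
  have hle : ∀ t, (Er f R δ μ t - Hc f δ t) ^ 2 ≤ 2 * Er f R δ μ t ^ 2 + 2 * Hc f δ t ^ 2 :=
    fun t => by nlinarith [sq_nonneg (Er f R δ μ t + Hc f δ t)]
  have hei : Integrable (fun t => (Er f R δ μ t - Hc f δ t) ^ 2) := by
    refine hsum.mono' ((hEm.sub (Hc_meas h.toKer).aestronglyMeasurable).pow 2)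
      (Eventually.of_forall fun t => ?_)
    rw [Real.norm_of_nonneg (sq_nonneg _)]; exact hle t
  have hGint : ∀ t, μ * G t + δ * (∫ s in (0:ℝ)..t, G s) = 1 - δ := by
    intro t
    have hd : ∀ x ∈ uIcc 0 t, HasDerivAt (fun s => -(μ / δ) * G s) (G x) x := by
      intro x _
      have h1 : HasDerivAt (fun s : ℝ => -(δ / μ) * s) (-(δ / μ)) x := by
        simpa using (hasDerivAt_id x).const_mul (-(δ / μ))
      have := ((h1.exp).const_mul A).const_mul (-(μ / δ))
      have hne : μ ≠ 0 := hμ0.ne'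
      have hne2 : δ ≠ 0 := hδ.ne'
      have e : -(μ / δ) * (A * (Real.exp (-(δ / μ) * x) * -(δ / μ))) = G x := by
        rw [show G x = A * Real.exp (-(δ / μ) * x) from rfl]
        field_simp
      rw [e] at this
      exact this
    rw [intervalIntegral.integral_eq_sub_of_hasDerivAt hd (hGc.intervalIntegrable _ _)]
    have : G 0 = A := by simp [hG]
    rw [this, hA]; field_simp; ring
  have heq : ∀ t, 0 ≤ t → μ * z t + δ * (∫ s in (0:ℝ)..t, z s) = Er f R δ μ t - Hc f δ t := by
    intro t ht
    have e1 : ∫ s in (0:ℝ)..t, z s = (∫ s in (0:ℝ)..t, R s) - ∫ s in (0:ℝ)..t, G s :=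
      intervalIntegral.integral_sub h.Rint.intervalIntegrable (hGc.intervalIntegrable _ _)
    have e2 := HR_eq h t
    rw [u_interval h t ht] at e2
    have e3 : Hc f δ t = 1 - δ - Fc f t := by
      unfold Hc; rw [indicator_of_mem (by exact ht)]
    have e4 := hGint t
    have e5 : z t = R t - G t := rfl
    unfold Er
    rw [e1, e2, e3, e5]
    linarith
  have hT : ∀ T : ℝ, 0 ≤ T → ∫ t in (0:ℝ)..T, z t ^ 2 ≤
      2 / μ * (∫ s, Hc f δ s * D2 R s) + 2 / μ := by
    intro T hT
    have hb := z_bound z (fun t => Er f R δ μ t - Hc f δ t) T μ δ hT hμ0 hδ.le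
      (h.Rint.intervalIntegrable.sub (hGc.intervalIntegrable _ _))
      ((intervalIntegrable_iff_integrableOn_Ioc_of_le hT).2 (hz2.mono_set Ioc_subset_Ioi_self))
      hei.intervalIntegrable heq
    have c1 : ∫ t in (0:ℝ)..T, (Er f R δ μ t - Hc f δ t) ^ 2 ≤
        ∫ t, (2 * Er f R δ μ t ^ 2 + 2 * Hc f δ t ^ 2) := by
      rw [intervalIntegral.integral_of_le hT]
      exact (setIntegral_le_integral hei (Eventually.of_forall fun t => sq_nonneg _)).trans
        (integral_mono hei hsum hle)
    rw [integral_add (hEi.const_mul 2) (hH2.const_mul 2), integral_const_mul,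
      integral_const_mul] at c1
    have c2 : μ ^ 2 * ∫ t in (0:ℝ)..T, z t ^ 2 ≤
      μ ^ 2 * (2 / μ * (∫ s, Hc f δ s * D2 R s) + 2 / μ) := by
      have : μ ^ 2 * (2 / μ * (∫ s, Hc f δ s * D2 R s) + 2 / μ) =
        2 * (μ * ∫ s, Hc f δ s * D2 R s) + 2 * μ := by field_simp
      rw [this]; linarith
    exact le_of_mul_le_mul_left c2 (by positivity)
  refine le_of_tendsto (intervalIntegral_tendsto_integral_Ioi 0 hz2 tendsto_id) ?_
  filter_upwards [eventually_ge_atTop 0] with T h0 using hT T h0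

/-- the final quantitative bound -/
lemma quant (h : Ren f R B δ) (hH : Integrable (Hc f δ)) (μ : ℝ) (hμ : ∫ s, Hc f δ s = μ)
    (hμ0 : 0 < μ) (S : ℝ) (hS : ∀ t, R t ≤ S) (s₀ c₀ : ℝ) (hs0 : 0 < s₀)
    (hc0 : 0 < c₀) (hf : ∀ s ∈ Ico 0 s₀, c₀ ≤ f s) (k : ℕ) :
    ∫ t in Ioi 0, (R t - (1 - δ) / μ * Real.exp (-(δ / μ) * t)) ^ 2 ≤
      2 * (4 ^ k * (16 * S / (c₀ * s₀))) + 2 / μ +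
      2 / μ * (2 * S / δ * ∫ s in Ioi (2 ^ k * (s₀ / 2)), Hc f δ s) := by
  refine (main_bound h hH μ hμ hμ0).2.trans ?_
  have hδ := h.pos
  have hSnn : 0 ≤ S := (h.Rnn 0).trans (hS 0)
  set K := 4 ^ k * (16 * S / (c₀ * s₀)) with hK
  have hKnn : 0 ≤ K := by positivity
  set L := 2 ^ k * (s₀ / 2) with hL
  have hN : 2 * ∫ t, R t * R t ≤ 2 * S / δ := by
    rw [le_div_iff₀ hδ]; linarith [(energy_le h S hS).1]
  have : ∫ s, Hc f δ s * D2 R s ≤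
      ∫ s, (K * Hc f δ s + 2 * S / δ * (Ioi L).indicator (Hc f δ) s) := by
    apply integral_mono (mul_D2_int h hH)
      ((hH.const_mul _).add ((hH.indicator measurableSet_Ioi).const_mul _))
    intro s
    simp only [Pi.add_apply]
    have hn := Hc_nn h.toKer s
    by_cases hs : s ∈ Ioi L
    · rw [indicator_of_mem hs]
      have := mul_le_mul_of_nonneg_left ((D2_le_norm h s).trans hN) hn
      nlinarith [mul_nonneg hKnn hn]
    · rw [indicator_of_notMem hs]
      by_cases h0 : 0 ≤ s
      · have := D2_pow h S hS s₀ c₀ hs0 hc0 hf k s h0 (by simpa using hs)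
        nlinarith [mul_le_mul_of_nonneg_left this hn]
      · have : Hc f δ s = 0 := by unfold Hc; rw [indicator_of_notMem (by simpa using h0)]
        rw [this]; simp
  rw [integral_add (hH.const_mul _) ((hH.indicator measurableSet_Ioi).const_mul _),
    integral_const_mul, integral_const_mul, hμ, integral_indicator measurableSet_Ioi] at this
  have := mul_le_mul_of_nonneg_left this (by positivity : 0 ≤ 2 / μ)
  have e : 2 / μ * (K * μ) = 2 * K := by field_simp
  rw [mul_add, e] at this
  linarith
end fin

section tails
variable {f R : ℝ → ℝ} {B δ : ℝ}

lemma Hc_eq (h : Ker f B δ) (s : ℝ) (hs : 0 ≤ s) : Hc f δ s = ∫ t in Ioi s, f t := by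
  unfold Hc Fc
  rw [indicator_of_mem (by exact hs)]
  have := integral_add_compl (measurableSet_Iic (a := s)) h.int
  rw [compl_Iic, h.tot] at this
  linarith

lemma tail_tonelli (h : Ker f B δ) (h1 : Integrable (fun t => t * f t)) (L : ℝ) (hL : 0 ≤ L) :
    IntegrableOn (Hc f δ) (Ioi L) ∧
    ∫ s in Ioi L, Hc f δ s = ∫ t in Ioi L, (t - L) * f t := by
  have hm : MeasurableSet {p : ℝ × ℝ | p.1 < p.2} := measurableSet_lt measurable_fst measurable_snd
  let φ : ℝ × ℝ → ℝ := {p : ℝ × ℝ | p.1 < p.2}.indicator (fun p => f p.2)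
  have hφm : Measurable φ := (h.meas.comp measurable_snd).indicator hm
  have sec : ∀ t, ∀ s, φ (s, t) = (Iio t).indicator (fun _ => f t) s := fun t s => by
    simp [φ, indicator]
  have sec' : ∀ s, ∀ t, φ (s, t) = (Ioi s).indicator f t := fun s t => by
    simp [φ, indicator]
  have inner : ∀ t, ∫ s in Ioi L, φ (s, t) = (Ioi L).indicator (fun t => (t - L) * f t) t := by
    intro t
    simp_rw [sec]
    rw [integral_indicator measurableSet_Iio, Measure.restrict_restrict measurableSet_Iio,
      integral_const, Iio_inter_Ioi]
    by_cases ht : L < t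
    · rw [indicator_of_mem (by exact ht)]
      simp [ht.le]
    · rw [indicator_of_notMem (by exact ht)]
      simp at ht
      simp [ht]
  have hint1 : Integrable (fun t => (Ioi L).indicator (fun t => (t - L) * f t) t) := by
    apply Integrable.indicator _ measurableSet_Ioi
    have : (fun t => (t - L) * f t) = fun t => t * f t - L * f t := by ext t; ring
    rw [this]; exact h1.sub (h.int.const_mul L)
  have hφ : Integrable φ ((volume.restrict (Ioi L)).prod volume) := by
    rw [integrable_prod_iff' hφm.aestronglyMeasurable]
    constructor
    · refine Eventually.of_forall fun t => ?_
      simp_rw [sec]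
      rw [integrable_indicator_iff measurableSet_Iio, IntegrableOn,
        Measure.restrict_restrict measurableSet_Iio, Iio_inter_Ioi]
      simp
    · have : ∀ t, ∫ s in Ioi L, ‖φ (s, t)‖ = (Ioi L).indicator (fun t => (t - L) * f t) t := by
        intro t; rw [← inner t]; congr 1; ext s
        rw [Real.norm_of_nonneg]
        exact indicator_nonneg (fun p _ => h.nn _) _
      simp_rw [this]; exact hint1
  have houter : ∀ s ∈ Ioi L, ∫ t, φ (s, t) = Hc f δ s := by
    intro s hs
    simp_rw [sec']
    rw [integral_indicator measurableSet_Ioi, Hc_eq h s (hL.trans (le_of_lt hs))]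
  constructor
  · refine (integrableOn_congr_fun houter measurableSet_Ioi).1 ?_
    exact hφ.integral_prod_left
  · rw [← setIntegral_congr_fun measurableSet_Ioi houter]
    rw [integral_integral_swap (f := fun s t => φ (s, t)) hφ]
    simp_rw [inner]
    rw [integral_indicator measurableSet_Ioi]

lemma Hc_total (h : Ker f B δ) (h1 : Integrable (fun t => t * f t)) :
    Integrable (Hc f δ) ∧ ∫ s, Hc f δ s = ∫ t in Ioi 0, t * f t := by
  obtain ⟨a, b⟩ := tail_tonelli h h1 0 le_rfl
  have e : Hc f δ = (Ici 0).indicator (Hc f δ) := by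
    ext s; unfold Hc; simp [indicator]
    intro a b; linarith
  have a' := (integrableOn_Ici_iff_integrableOn_Ioi (by simp)).2 a
  constructor
  · rw [e]; exact (integrable_indicator_iff measurableSet_Ici).2 a'
  · conv_lhs => rw [e]
    rw [integral_indicator measurableSet_Ici, integral_Ici_eq_integral_Ioi, b]
    simp

lemma lower (h : Ker f B δ) (h1 : Integrable (fun t => t * f t)) (hB : 0 < B)
    (hanti : ∀ s t, 0 ≤ s → s ≤ t → f t ≤ f s) (hδ : δ ≤ 1/4) (M : ℝ) (hM : 0 < M)
    (hM1 : ∫ t, t * f t ≤ M) : 1 / (16 * M) ≤ f (1 / (4 * B)) := by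
  set s₀ := 1 / (4 * B) with hs
  have hs0 : 0 < s₀ := by positivity
  set S := 4 * M with hS
  have hS0 : 0 < S := by positivity
  have i1 : Integrable ((Icc 0 s₀).indicator (fun _ => B)) :=
    (integrable_indicator_iff measurableSet_Icc).2 (by simp)
  have i2 : Integrable ((Icc 0 S).indicator (fun _ => f s₀)) :=
    (integrable_indicator_iff measurableSet_Icc).2 (by simp)
  have i3 : Integrable (fun t => (1 / S) * (t * f t)) := h1.const_mul _
  have i4 : Integrable (fun t => (Icc 0 s₀).indicator (fun _ => B) t +
      (Icc 0 S).indicator (fun _ => f s₀) t) := i1.add i2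
  have key : ∫ t, f t ≤ ∫ t, ((Icc 0 s₀).indicator (fun _ => B) t +
      (Icc 0 S).indicator (fun _ => f s₀) t + (1 / S) * (t * f t)) := by
    apply integral_mono h.int (i4.add i3)
    intro t
    simp only [Pi.add_apply]
    have n1 : 0 ≤ (Icc 0 s₀).indicator (fun _ => B) t := indicator_nonneg (fun _ _ => hB.le) _
    have n2 : 0 ≤ (Icc 0 S).indicator (fun _ => f s₀) t := indicator_nonneg (fun _ _ => h.nn _) _
    by_cases h0 : t < 0
    · rw [h.neg t h0]; linarith
    · push Not at h0
      have n3 : 0 ≤ (1 / S) * (t * f t) := by have := h.nn t; positivity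
      by_cases h2 : t ≤ s₀
      · rw [indicator_of_mem (show t ∈ Icc 0 s₀ from ⟨h0, h2⟩)]; linarith [h.le t]
      · by_cases h3 : t ≤ S
        · rw [indicator_of_mem (show t ∈ Icc 0 S from ⟨h0, h3⟩)]
          linarith [hanti s₀ t hs0.le (by linarith)]
        · have : f t ≤ (1 / S) * (t * f t) := by
            rw [one_div, ← div_eq_inv_mul, le_div_iff₀ hS0]
            nlinarith [h.nn t]
          linarith
  rw [integral_add i4 i3, integral_add i1 i2, integral_const_mul, h.tot,
    integral_indicator measurableSet_Icc, integral_indicator measurableSet_Icc] at key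
  simp only [integral_const, measureReal_restrict_apply_univ, Real.volume_real_Icc, sub_zero,
      smul_eq_mul, max_eq_left hs0.le, max_eq_left hS0.le] at key
  have e1 : s₀ * B = 1/4 := by rw [hs]; field_simp
  have e2 : 1 / S * ∫ t, t * f t ≤ 1/4 := by
    rw [one_div, ← div_eq_inv_mul, div_le_iff₀ hS0]; linarith
  rw [div_le_iff₀ (by positivity)]
  linarith
end tails

section meas

lemma markov_tail {ν : Measure ℝ} [IsProbabilityMeasure ν] (h0 : ν (Iio 0) = 0) (p : ℝ) (hp : 0 < p)
    (hi : Integrable (fun t => t ^ p) ν) (t : ℝ) (ht : 0 < t) :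
    (ν (Ioi t)).toReal ≤ (∫ x, x ^ p ∂ν) * t ^ (-p) := by
  have hae : ∀ᵐ x ∂ν, 0 ≤ x := by
    rw [ae_iff]; simpa [Iio] using h0
  have nn : 0 ≤ᵐ[ν] fun x => x ^ p := by
    filter_upwards [hae] with x hx using Real.rpow_nonneg hx p
  have := mul_meas_ge_le_integral_of_nonneg nn hi (t ^ p)
  have hsub : ν.real (Ioi t) ≤ ν.real {x | t ^ p ≤ x ^ p} := by
    refine measureReal_mono ?_ (measure_ne_top _ _)
    intro x hx
    exact Real.rpow_le_rpow ht.le (le_of_lt hx) hp.le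
  rw [Real.rpow_neg ht.le, ← div_eq_mul_inv, le_div_iff₀ (Real.rpow_pos_of_pos ht p)]
  calc _ ≤ ν.real {x | t ^ p ≤ x ^ p} * t ^ p :=
        mul_le_mul_of_nonneg_right hsub (Real.rpow_nonneg ht.le _)
    _ ≤ _ := by rw [mul_comm]; exact this

lemma layer1 {ν : Measure ℝ} [IsProbabilityMeasure ν] (h0 : ν (Iio 0) = 0)
    (hi : Integrable (fun t => t) ν) : ∫ t in Ioi 0, (ν (Ioi t)).toReal = ∫ x, x ∂ν := by
  have hae : ∀ᵐ x ∂ν, 0 ≤ x := by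
    rw [ae_iff]; simpa [Iio] using h0
  exact (hi.integral_eq_integral_meas_lt hae).symm

lemma layer2 {ν : Measure ℝ} [IsProbabilityMeasure ν] (h0 : ν (Iio 0) = 0)
    (hi : Integrable (fun t => t ^ 2) ν) :
    ∫ t in Ioi 0, t * (ν (Ioi t)).toReal = (1/2) * ∫ x, x ^ 2 ∂ν := by
  have hae : ∀ᵐ x ∂ν, 0 ≤ x := by
    rw [ae_iff]; simpa [Iio] using h0
  have hanti : Antitone (fun t => (ν (Ioi t)).toReal) := fun s t hst =>
    measureReal_mono (Ioi_subset_Ioi hst)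
  have key := lintegral_comp_eq_lintegral_meas_lt_mul ν (f := fun x => x) (g := fun t => t) hae
    aemeasurable_id (fun t _ => by simp)
    ((ae_restrict_iff' measurableSet_Ioi).2 (Eventually.of_forall fun t ht => le_of_lt ht))
  rw [← integral_const_mul, integral_eq_lintegral_of_nonneg_ae, integral_eq_lintegral_of_nonneg_ae]
  · congr 1
    have e : ∀ x : ℝ, ∫ t in (0:ℝ)..x, t = 1/2 * x ^ 2 := fun x => by
      rw [integral_id]; ring
    simp_rw [e] at key
    rw [key]
    apply setLIntegral_congr_fun measurableSet_Ioi
    intro t ht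
    dsimp only
    rw [ENNReal.ofReal_mul (le_of_lt ht), ENNReal.ofReal_toReal (measure_ne_top _ _), mul_comm]
    rfl
  · exact Eventually.of_forall fun x => by simp; positivity
  · exact (hi.const_mul _).1
  · exact (ae_restrict_iff' measurableSet_Ioi).2 (Eventually.of_forall fun t ht =>
      mul_nonneg (le_of_lt ht) ENNReal.toReal_nonneg)
  · exact (measurable_id.mul hanti.measurable).aestronglyMeasurable
end meas

section limits

lemma conv_aux (f R : ℕ → ℝ → ℝ) (δ μ γ : ℕ → ℝ) (B S s₀ c₀ c μ0 : ℝ) (T : ℝ → ℝ)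
    (hs0 : 0 < s₀) (hc0 : 0 < c₀) (hγ_pos : ∀ n, 0 < γ n)
    (hγ_top : Tendsto γ atTop atTop) (hc : 0 < c) (hμ0 : 0 < μ0)
    (hT : Tendsto T atTop (nhds 0))
    (hδ : Tendsto (fun n => γ n * δ n) atTop (nhds c)) (hμ : Tendsto μ atTop (nhds μ0))
    (hev : ∀ᶠ n in atTop, Ren (f n) (R n) B (δ n) ∧ Integrable (Hc (f n) (δ n)) ∧
      ∫ s, Hc (f n) (δ n) s = μ n ∧ 0 < μ n ∧ (∀ t, R n t ≤ S) ∧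
      (∀ s ∈ Ico 0 s₀, c₀ ≤ f n s) ∧ (∀ L, 0 ≤ L → ∫ s in Ioi L, Hc (f n) (δ n) s ≤ T L)) :
    Tendsto (fun n => ∫ t in Ioi 0, (R n (γ n * t) -
      (1 - δ n) / μ n * Real.exp (-(γ n * δ n / μ n) * t)) ^ 2) atTop (nhds 0) := by
  have hγi : Tendsto (fun n => (γ n)⁻¹) atTop (nhds 0) := hγ_top.inv_tendsto_atTop
  have hLk : Tendsto (fun k : ℕ => (2:ℝ) ^ k * (s₀ / 2)) atTop atTop :=
    (tendsto_pow_atTop_atTop_of_one_lt (by norm_num)).atTop_mul_const (by positivity)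
  have hTk : Tendsto (fun k : ℕ => 2 / μ0 * (2 * S / c * T ((2:ℝ) ^ k * (s₀ / 2)))) atTop (nhds 0) := by
    have := ((hT.comp hLk).const_mul (2 * S / c)).const_mul (2 / μ0)
    simpa using this
  have lim : ∀ k : ℕ, Tendsto (fun n => (γ n)⁻¹ * (2 * (4 ^ k * (16 * S / (c₀ * s₀))) + 2 / μ n) +
      2 / μ n * (2 * S / (γ n * δ n) * T ((2:ℝ) ^ k * (s₀ / 2)))) atTop
      (nhds (2 / μ0 * (2 * S / c * T ((2:ℝ) ^ k * (s₀ / 2))))) := by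
    intro k
    have h2 : Tendsto (fun n => 2 / μ n) atTop (nhds (2 / μ0)) :=
      tendsto_const_nhds.div hμ hμ0.ne'
    have h3 : Tendsto (fun n => 2 * S / (γ n * δ n)) atTop (nhds (2 * S / c)) :=
      tendsto_const_nhds.div hδ hc.ne'
    have := (hγi.mul (h2.const_add (2 * (4 ^ k * (16 * S / (c₀ * s₀)))))).add
      (h2.mul (h3.mul_const (T ((2:ℝ) ^ k * (s₀ / 2)))))
    simpa using this
  rw [Metric.tendsto_atTop']
  intro ε hε
  obtain ⟨k, hk⟩ := (hTk.eventually (gt_mem_nhds hε)).exists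
  have := ((lim k).eventually (gt_mem_nhds hk)).and hev
  obtain ⟨N, hN⟩ := eventually_atTop.1 this
  refine ⟨N, fun n hn => ?_⟩
  obtain ⟨h1, hR, hH, hμn, hμp, hS, hf, hTT⟩ := hN n hn.le
  have hnn : 0 ≤ ∫ t in Ioi 0, (R n (γ n * t) -
      (1 - δ n) / μ n * Real.exp (-(γ n * δ n / μ n) * t)) ^ 2 :=
    integral_nonneg fun t => sq_nonneg _
  rw [Real.dist_eq, sub_zero, abs_of_nonneg hnn]
  refine lt_of_le_of_lt ?_ h1
  have e : ∫ t in Ioi 0, (R n (γ n * t) -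
      (1 - δ n) / μ n * Real.exp (-(γ n * δ n / μ n) * t)) ^ 2 = (γ n)⁻¹ *
      ∫ t in Ioi 0, (R n t - (1 - δ n) / μ n * Real.exp (-(δ n / μ n) * t)) ^ 2 := by
    have := integral_comp_mul_left_Ioi
      (fun t => (R n t - (1 - δ n) / μ n * Real.exp (-(δ n / μ n) * t)) ^ 2) 0 (hγ_pos n)
    rw [mul_zero, smul_eq_mul] at this
    rw [← this]
    congr 1; ext t
    congr 4; ring
  rw [e]
  have q := quant hR hH (μ n) hμn hμp S hS s₀ c₀ hs0 hc0 hf k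
  have hδp := hR.pos
  have hg := hγ_pos n
  have hSnn : 0 ≤ S := (hR.Rnn 0).trans (hS 0)
  have q2 := mul_le_mul_of_nonneg_left (hTT (2 ^ k * (s₀ / 2)) (by positivity))
    (show 0 ≤ 2 / μ n * (2 * S / δ n) by positivity)
  have qq : _ ≤ 2 * (4 ^ k * (16 * S / (c₀ * s₀))) + 2 / μ n +
      2 / μ n * (2 * S / δ n) * T (2 ^ k * (s₀ / 2)) := q.trans (by linarith)
  have q3 := mul_le_mul_of_nonneg_left (qq) (inv_nonneg.2 hg.le)
  refine q3.trans (le_of_eq ?_)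
  field_simp

lemma exp_conv (A ρ : ℕ → ℝ) (A0 ρ0 : ℝ) (hA : Tendsto A atTop (nhds A0))
    (hρ : Tendsto ρ atTop (nhds ρ0)) (hρ0 : 0 < ρ0) :
    Tendsto (fun n => ∫ t in Ioi 0, (A n * Real.exp (-(ρ n) * t) - A0 * Real.exp (-ρ0 * t)) ^ 2)
      atTop (nhds 0) ∧
    ∀ᶠ n in atTop, IntegrableOn (fun t => (A n * Real.exp (-(ρ n) * t) - A0 * Real.exp (-ρ0 * t)) ^ 2) (Ioi 0) := by
  have eA : ∀ᶠ n in atTop, |A n| < |A0| + 1 := hA.abs.eventually (gt_mem_nhds (by linarith))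
  have eρ : ∀ᶠ n in atTop, ρ0 / 2 < ρ n := hρ.eventually (lt_mem_nhds (by linarith))
  have bI : IntegrableOn (fun t => (2 * (|A0| + 1)) ^ 2 * Real.exp (-ρ0 * t)) (Ioi 0) :=
    (exp_neg_integrableOn_Ioi 0 hρ0).const_mul _
  have meas : ∀ n, AEStronglyMeasurable (fun t => (A n * Real.exp (-(ρ n) * t) - A0 * Real.exp (-ρ0 * t)) ^ 2)
      (volume.restrict (Ioi 0)) := fun n => by
    apply Continuous.aestronglyMeasurable; fun_prop
  have bd : ∀ᶠ n in atTop, ∀ᵐ t ∂(volume.restrict (Ioi (0:ℝ))),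
      ‖(A n * Real.exp (-(ρ n) * t) - A0 * Real.exp (-ρ0 * t)) ^ 2‖ ≤
        (2 * (|A0| + 1)) ^ 2 * Real.exp (-ρ0 * t) := by
    filter_upwards [eA, eρ] with n h1 h2
    refine (ae_restrict_iff' measurableSet_Ioi).2 (Eventually.of_forall fun t ht => ?_)
    have ht : 0 < t := ht
    have e1 : Real.exp (-(ρ n) * t) ≤ Real.exp (-(ρ0 / 2) * t) :=
      Real.exp_le_exp.2 (by nlinarith)
    have e2 : Real.exp (-ρ0 * t) ≤ Real.exp (-(ρ0 / 2) * t) :=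
      Real.exp_le_exp.2 (by nlinarith)
    have e3 : Real.exp (-ρ0 * t) = Real.exp (-(ρ0 / 2) * t) ^ 2 := by
      rw [← Real.exp_nat_mul]; congr 1; push_cast; ring
    have b1 : |A n * Real.exp (-(ρ n) * t)| ≤ (|A0| + 1) * Real.exp (-(ρ0 / 2) * t) := by
      rw [abs_mul, abs_of_pos (Real.exp_pos _)]
      exact mul_le_mul h1.le e1 (Real.exp_pos _).le (by positivity)
    have b2 : |A0 * Real.exp (-ρ0 * t)| ≤ (|A0| + 1) * Real.exp (-(ρ0 / 2) * t) := by
      rw [abs_mul, abs_of_pos (Real.exp_pos _)]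
      exact mul_le_mul (by linarith) e2 (Real.exp_pos _).le (by positivity)
    rw [norm_pow, Real.norm_eq_abs, e3, ← mul_pow, ← e3]
    apply pow_le_pow_left₀ (abs_nonneg _)
    refine (abs_sub _ _).trans ?_
    linarith
  constructor
  · have := tendsto_integral_filter_of_dominated_convergence
      (F := fun n t => (A n * Real.exp (-(ρ n) * t) - A0 * Real.exp (-ρ0 * t)) ^ 2) (f := fun _ => (0:ℝ))
      (μ := volume.restrict (Ioi (0:ℝ))) _ (Eventually.of_forall meas) bd bI
      (Eventually.of_forall fun t => by
        have : Tendsto (fun n => (A n * Real.exp (-(ρ n) * t) - A0 * Real.exp (-ρ0 * t)) ^ 2) atTop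
          (nhds ((A0 * Real.exp (-ρ0 * t) - A0 * Real.exp (-ρ0 * t)) ^ 2)) :=
          ((hA.mul ((Real.continuous_exp.tendsto _).comp (hρ.neg.mul_const t))).sub_const _).pow 2
        simpa using this)
    simpa using this
  · filter_upwards [bd] with n h
    exact Integrable.mono' bI (meas n) h

/-- Full convergence, in an abstract form. -/
lemma conv_final (f R : ℕ → ℝ → ℝ) (δ μ γ : ℕ → ℝ) (B S s₀ c₀ c μ0 : ℝ) (T : ℝ → ℝ)
    (hs0 : 0 < s₀) (hc0 : 0 < c₀) (hγ_pos : ∀ n, 0 < γ n)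
    (hγ_top : Tendsto γ atTop atTop) (hc : 0 < c) (hμ0 : 0 < μ0)
    (hT : Tendsto T atTop (nhds 0))
    (hδ : Tendsto (fun n => γ n * δ n) atTop (nhds c)) (hμ : Tendsto μ atTop (nhds μ0))
    (hev : ∀ᶠ n in atTop, Ren (f n) (R n) B (δ n) ∧ Integrable (Hc (f n) (δ n)) ∧
      ∫ s, Hc (f n) (δ n) s = μ n ∧ 0 < μ n ∧ (∀ t, R n t ≤ S) ∧
      (∀ s ∈ Ico 0 s₀, c₀ ≤ f n s) ∧ (∀ L, 0 ≤ L → ∫ s in Ioi L, Hc (f n) (δ n) s ≤ T L))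
    (κ : ℝ) (hκ : 1 ≤ κ) :
    Tendsto (fun n => ∫ t in Ioi 0, |R n (γ n * t) -
      1 / μ0 * Real.exp (-(c / μ0) * t)| ^ (2 * κ)) atTop (nhds 0) := by
  have l1 := conv_aux f R δ μ γ B S s₀ c₀ c μ0 T hs0 hc0 hγ_pos hγ_top hc hμ0 hT hδ hμ hev
  have hδ0 : Tendsto δ atTop (nhds 0) := by
    have := hγ_top.inv_tendsto_atTop.mul hδ
    rw [zero_mul] at this
    refine this.congr fun n => ?_
    have := (hγ_pos n).ne'
    simp only [Pi.inv_apply]; field_simp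
  have hA : Tendsto (fun n => (1 - δ n) / μ n) atTop (nhds (1 / μ0)) := by
    have := (hδ0.const_sub 1).div hμ hμ0.ne'
    simpa [Pi.div_def] using this
  have hρ : Tendsto (fun n => γ n * δ n / μ n) atTop (nhds (c / μ0)) := hδ.div hμ hμ0.ne'
  obtain ⟨l2, i2⟩ := exp_conv _ _ _ _ hA hρ (by positivity)
  set P : ℝ := (S + 1 / μ0) ^ (2 * κ - 2) with hP
  have hlim := ((l1.const_mul 2).add (l2.const_mul 2)).const_mul P
  simp only [mul_zero, add_zero] at hlim
  refine squeeze_zero' (Eventually.of_forall fun n => integral_nonneg fun t => by positivity) ?_ hlim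
  filter_upwards [hev, i2] with n ⟨hR, hH, hμn, hμp, hS, _, _⟩ hi2
  have hSnn : 0 ≤ S := (hR.Rnn 0).trans (hS 0)
  have i1 : IntegrableOn (fun t => (R n (γ n * t) -
      (1 - δ n) / μ n * Real.exp (-(γ n * δ n / μ n) * t)) ^ 2) (Ioi 0) := by
    have := (integrableOn_Ioi_comp_mul_left_iff _ 0 (hγ_pos n)).2
      (by rw [mul_zero]; exact (main_bound hR hH (μ n) hμn hμp).1)
    refine this.congr_fun (fun t _ => ?_) measurableSet_Ioi
    dsimp only
    congr 4; ring
  rw [← integral_const_mul, ← integral_const_mul, ← integral_add (i1.const_mul 2) (hi2.const_mul 2),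
    ← integral_const_mul]
  apply integral_mono_of_nonneg (Eventually.of_forall fun t => by simp only [Pi.zero_apply]; positivity)
    (((i1.const_mul 2).add (hi2.const_mul 2)).const_mul P)
  refine (ae_restrict_iff' measurableSet_Ioi).2 (Eventually.of_forall fun t ht => ?_)
  have ht : 0 < t := ht
  dsimp only
  set x := R n (γ n * t)
  set g := 1 / μ0 * Real.exp (-(c / μ0) * t) with hg
  set y := (1 - δ n) / μ n * Real.exp (-(γ n * δ n / μ n) * t)
  have hg0 : 0 ≤ g := by positivity
  have hg1 : g ≤ 1 / μ0 := by
    have : Real.exp (-(c / μ0) * t) ≤ 1 := by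
      rw [Real.exp_le_one_iff]
      have : 0 ≤ c / μ0 * t := by positivity
      linarith
    exact mul_le_of_le_one_right (by positivity) this
  have hx0 : 0 ≤ x := hR.Rnn _
  have hx1 : x ≤ S := hS _
  have hμi : 0 < 1 / μ0 := by positivity
  have habs : |x - g| ≤ S + 1 / μ0 := by rw [abs_le]; constructor <;> linarith
  have h1 : |x - g| ^ (2 * κ) = |x - g| ^ (2 * κ - 2) * (x - g) ^ 2 := by
    rw [← sq_abs (x - g), ← Real.rpow_natCast, ← Real.rpow_add_of_nonneg (abs_nonneg _) (by linarith) (by norm_num)]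
    congr 1; push_cast; ring
  rw [h1]
  apply mul_le_mul _ _ (sq_nonneg _) (by positivity)
  · exact Real.rpow_le_rpow (abs_nonneg _) habs (by linarith)
  · show (x - g) ^ 2 ≤ 2 * (x - y) ^ 2 + 2 * (y - g) ^ 2
    nlinarith [sq_nonneg ((x - y) - (y - g))]

lemma exp_neg_bound (x : ℝ) (hx : 0 ≤ x) : Real.exp (-x) ≤ 1 - x + x ^ 2 := by
  rw [Real.exp_neg, inv_le_iff_one_le_mul₀ (Real.exp_pos _)]
  have h1 : x + 1 ≤ Real.exp x := Real.add_one_le_exp x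
  have h2 : 0 < 1 - x + x ^ 2 := by nlinarith [sq_nonneg (x - 1)]
  nlinarith [pow_nonneg hx 3, mul_le_mul_of_nonneg_left h1 h2.le]

lemma lim_mu (G : ℕ → ℝ → ℝ) (W : ℝ → ℝ) (γ : ℕ → ℝ) (β : ℝ) (hβ : 0 ≤ β)
    (hγ_pos : ∀ n, 0 < γ n) (hγ_top : Tendsto γ atTop atTop)
    (hGm : ∀ n, Measurable (G n)) (hG0 : ∀ n t, 0 ≤ G n t)
    (hW : IntegrableOn W (Ioi 0)) (hGW : ∀ n t, 0 < t → t * G n t ≤ W t) :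
    Tendsto (fun n => ∫ t in Ioi 0, (1 - Real.exp (-(β * t) / γ n)) * (t * G n t)) atTop (nhds 0) := by
  have hγi : Tendsto (fun n => (γ n)⁻¹) atTop (nhds 0) := hγ_top.inv_tendsto_atTop
  have ex : ∀ n t, 0 < t → 0 ≤ 1 - Real.exp (-(β * t) / γ n) ∧ 1 - Real.exp (-(β * t) / γ n) ≤ 1 := by
    intro n t ht
    have hg := hγ_pos n
    have h1 := Real.exp_pos (-(β * t) / γ n)
    have h2 : Real.exp (-(β * t) / γ n) ≤ 1 := by
      rw [Real.exp_le_one_iff, neg_div]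
      have : 0 ≤ β * t / γ n := by positivity
      linarith
    constructor <;> linarith
  have := tendsto_integral_filter_of_dominated_convergence (l := atTop)
      (F := fun n t => (1 - Real.exp (-(β * t) / γ n)) * (t * G n t)) (f := fun _ => (0:ℝ))
      (μ := volume.restrict (Ioi (0:ℝ))) W
      (Eventually.of_forall fun n => by
        have := hGm n
        apply Measurable.aestronglyMeasurable; fun_prop)
      (Eventually.of_forall fun n => (ae_restrict_iff' measurableSet_Ioi).2
        (Eventually.of_forall fun t ht => by
          have ht : 0 < t := ht
          obtain ⟨a, b⟩ := ex n t ht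
          have hnn : 0 ≤ t * G n t := mul_nonneg ht.le (hG0 n t)
          rw [Real.norm_of_nonneg (mul_nonneg a hnn)]
          exact (mul_le_of_le_one_left hnn b).trans (hGW n t ht))) hW
      ((ae_restrict_iff' measurableSet_Ioi).2 (Eventually.of_forall fun t ht => by
        have ht : 0 < t := ht
        have lim : Tendsto (fun n => (1 - Real.exp (-(β * t) / γ n)) * W t) atTop (nhds 0) := by
          have := ((((Real.continuous_exp.tendsto _).comp (hγi.const_mul (-(β * t)))).const_sub 1).mul_const (W t))
          simpa [div_eq_mul_inv] using this
        refine squeeze_zero (fun n => mul_nonneg (ex n t ht).1 (mul_nonneg ht.le (hG0 n t))) (fun n => ?_) lim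
        exact mul_le_mul_of_nonneg_left (hGW n t ht) (ex n t ht).1))
  simpa using this

lemma lim_delta (G : ℕ → ℝ → ℝ) (W : ℝ → ℝ) (γ : ℕ → ℝ) (β : ℝ) (hβ : 0 ≤ β)
    (hγ_pos : ∀ n, 0 < γ n) (hγ_top : Tendsto γ atTop atTop)
    (hGm : ∀ n, Measurable (G n)) (hG0 : ∀ n t, 0 ≤ G n t)
    (hW : IntegrableOn W (Ioi 0)) (hGW : ∀ n t, 0 < t → G n t ≤ W t)
    (hGW' : ∀ n t, 0 < t → t * G n t ≤ W t) :
    Tendsto (fun n => ∫ t in Ioi 0, (β * t - γ n * (1 - Real.exp (-(β * t) / γ n))) * G n t)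
      atTop (nhds 0) := by
  have hγi : Tendsto (fun n => (γ n)⁻¹) atTop (nhds 0) := hγ_top.inv_tendsto_atTop
  have ex : ∀ n t, 0 < t → 0 ≤ β * t - γ n * (1 - Real.exp (-(β * t) / γ n)) ∧
      β * t - γ n * (1 - Real.exp (-(β * t) / γ n)) ≤ β * t ∧
      β * t - γ n * (1 - Real.exp (-(β * t) / γ n)) ≤ (β * t) ^ 2 * (γ n)⁻¹ := by
    intro n t ht
    have hg := hγ_pos n
    set x := β * t / γ n with hx
    have hx0 : 0 ≤ x := by positivity
    have e : β * t = γ n * x := by rw [hx]; field_simp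
    have e2 : -(β * t) / γ n = -x := by rw [hx, neg_div]
    have e3 : (β * t) ^ 2 * (γ n)⁻¹ = γ n * x ^ 2 := by rw [hx]; field_simp
    rw [e2, e3, e]
    have h1 : Real.exp (-x) ≤ 1 := by rw [Real.exp_le_one_iff]; linarith
    have h2 := exp_neg_bound x hx0
    have h3 := Real.add_one_le_exp (-x)
    refine ⟨?_, ?_, ?_⟩ <;> nlinarith
  have := tendsto_integral_filter_of_dominated_convergence (l := atTop)
      (F := fun n t => (β * t - γ n * (1 - Real.exp (-(β * t) / γ n))) * G n t) (f := fun _ => (0:ℝ))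
      (μ := volume.restrict (Ioi (0:ℝ))) (fun t => β * W t)
      (Eventually.of_forall fun n => by
        have := hGm n
        apply Measurable.aestronglyMeasurable; fun_prop)
      (Eventually.of_forall fun n => (ae_restrict_iff' measurableSet_Ioi).2
        (Eventually.of_forall fun t ht => by
          have ht : 0 < t := ht
          obtain ⟨a, b, -⟩ := ex n t ht
          rw [Real.norm_of_nonneg (mul_nonneg a (hG0 n t))]
          calc _ ≤ β * t * G n t := mul_le_mul_of_nonneg_right b (hG0 n t)
            _ = β * (t * G n t) := by ring
            _ ≤ _ := mul_le_mul_of_nonneg_left (hGW' n t ht) hβ)) (hW.const_mul β)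
      ((ae_restrict_iff' measurableSet_Ioi).2 (Eventually.of_forall fun t ht => by
        have ht : 0 < t := ht
        have lim : Tendsto (fun n => ((β * t) ^ 2 * (γ n)⁻¹) * W t) atTop (nhds 0) := by
          have := (hγi.const_mul ((β * t) ^ 2)).mul_const (W t)
          simpa using this
        refine squeeze_zero (fun n => mul_nonneg (ex n t ht).1 (hG0 n t)) (fun n => ?_) lim
        have h3 := (ex n t ht).2.2
        exact mul_le_mul h3 (hGW n t ht) (hG0 n t) ((ex n t ht).1.trans h3)))
  simpa using this

end limits

lemma envelope (C₁ α : ℝ) (hα : 1 < α) :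
    IntegrableOn (fun t : ℝ => if t ≤ 1 then (1:ℝ) else C₁ * t ^ (1 - 2 * α)) (Ioi 0) := by
  rw [← Ioc_union_Ioi_eq_Ioi (zero_le_one (α := ℝ))]
  apply IntegrableOn.union
  · refine (integrableOn_const (C := (1:ℝ)) (s := Ioc (0:ℝ) 1) (μ := volume) (by simp)).congr_fun (fun t ht => ?_) measurableSet_Ioc
    simp [ht.2]
  · have hI : IntegrableOn (fun t : ℝ => C₁ * t ^ (1 - 2 * α)) (Ioi 1) :=
      (integrableOn_Ioi_rpow_of_lt (a := 1 - 2 * α) (by linarith) one_pos).const_mul C₁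
    refine hI.congr_fun
      (fun t ht => ?_) measurableSet_Ioi
    have ht : 1 < t := ht
    simp [not_le.2 ht]

lemma tail_zero (W : ℝ → ℝ) (hW : IntegrableOn W (Ioi 0)) :
    Tendsto (fun L : ℝ => ∫ t in Ioi L, W t) atTop (nhds 0) := by
  have := tendsto_setIntegral_of_antitone (f := W) (μ := volume) (s := fun L : ℝ => Ioi L)
    (fun _ => measurableSet_Ioi) (fun a b h => Ioi_subset_Ioi h) ⟨0, hW⟩
  have e : (⋂ L : ℝ, Ioi L) = ∅ := by
    ext x; simp only [mem_iInter, mem_Ioi, mem_empty_iff_false, iff_false]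
    exact fun h => lt_irrefl _ (h x)
  rw [e] at this
  simpa using this

theorem stmt16
    (β α : ℝ) (hβ : 0 ≤ β) (hα : α ∈ Set.Ioo (1:ℝ) 2)
    (Λ : ℕ → Measure ℝ) (hΛprob : ∀ n, IsProbabilityMeasure (Λ n))
    (hΛsupp : ∀ n, Λ n (Set.Iio 0) = 0)
    (lam m γ : ℕ → ℝ)
    (hlam_pos : ∀ n, 0 < lam n) (hm_pos : ∀ n, 0 < m n) (hγ_pos : ∀ n, 0 < γ n)
    (hγ_top : Tendsto γ atTop atTop)
    (Λbar : ℕ → ℝ → ℝ) (hΛbar : ∀ n t, Λbar n t = (Λ n (Set.Ioi t)).toReal)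
    (Λbarβ : ℕ → ℝ → ℝ)
    (hΛbarβ : ∀ n t, Λbarβ n t = Real.exp (-(β * t) / γ n) * Λbar n t)
    (ηβ : ℕ → ℝ) (hηβ : ∀ n, ηβ n = ∫ t in Set.Ioi (0:ℝ), Λbarβ n t)
    (lam0 η0 σ0 bm : ℝ) (hlam0 : 0 < lam0) (hη0 : 0 < η0) (hσ0 : 0 < σ0)
    (hbm_pos : 0 < bm + β * σ0 * lam0)
    (hmom1 : ∀ n, Integrable (fun t => t) (Λ n))
    (hmom2 : ∀ n, Integrable (fun t => t ^ 2) (Λ n))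
    (hlam_lim : Tendsto lam atTop (nhds lam0))
    (hm_lim : Tendsto m atTop (nhds 1))
    (hmean_lim : Tendsto (fun n => ∫ t, t ∂(Λ n)) atTop (nhds η0))
    (hsec_lim : Tendsto (fun n => (1/2) * ∫ t, t ^ 2 ∂(Λ n)) atTop (nhds σ0))
    (hγ_lim : Tendsto (fun n => γ n * (1 - lam n * m n * ∫ t, t ∂(Λ n))) atTop (nhds bm))
    (C₀ : ℝ) (hC₀ : 0 < C₀)
    (Λstar : Measure ℝ) (hstar_prob : IsProbabilityMeasure Λstar)
    (hstar_supp : Λstar (Set.Iio 0) = 0)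
    (hstar_mom : Integrable (fun t => t ^ (2 * α)) Λstar)
    (hdom : ∀ n, ∀ t : ℝ, 0 ≤ t → Λbar n t ≤ C₀ * (Λstar (Set.Ioi t)).toReal)
    (Rβ : ℕ → ℝ → ℝ) (hRβ : ∀ n t, Rβ n t = resolventFn (lam n * m n) (Λbarβ n) t)
 :
    ∀ κ : ℝ, 1 ≤ κ →
      Tendsto (fun n => ∫ t in Set.Ioi (0:ℝ),
          |Rβ n (γ n * t) - (1 / (σ0 * lam0)) * Real.exp (-(bm / (σ0 * lam0) + β) * t)| ^ (2 * κ))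
        atTop (nhds 0) := by
  intro κ hκ
  have hα1 : 1 < α := hα.1
  obtain ⟨W, hWdef⟩ : ∃ W : ℝ → ℝ, W = fun t => if t ≤ 1 then (1:ℝ) else
    (C₀ * ∫ x, x ^ (2 * α) ∂Λstar) * t ^ (1 - 2 * α) := ⟨_, rfl⟩
  have hW : IntegrableOn W (Ioi 0) := by rw [hWdef]; exact envelope _ α hα1
  have hG0 : ∀ n t, 0 ≤ Λbar n t := fun n t => by rw [hΛbar]; exact ENNReal.toReal_nonneg
  have hG1 : ∀ n t, Λbar n t ≤ 1 := fun n t => by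
    have := hΛprob n
    rw [hΛbar]; exact measureReal_le_one
  have hGanti : ∀ n, Antitone (Λbar n) := fun n s t hst => by
    have := hΛprob n
    rw [hΛbar, hΛbar]
    exact measureReal_mono (Ioi_subset_Ioi hst)
  have hGm : ∀ n, Measurable (Λbar n) := fun n => (hGanti n).measurable
  have hGW' : ∀ n t, 0 < t → t * Λbar n t ≤ W t := by
    intro n t ht
    rw [hWdef]
    by_cases h1 : t ≤ 1
    · simp only [h1, if_true]
      exact mul_le_one₀ h1 (hG0 n t) (hG1 n t)
    · simp only [h1, if_false]
      have h2 := markov_tail hstar_supp (2 * α) (by linarith) hstar_mom t ht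
      have h3 := hdom n t ht.le
      have e : t ^ (1 - 2 * α) = t * t ^ (-(2 * α)) := by
        rw [sub_eq_add_neg, Real.rpow_add ht, Real.rpow_one]
      rw [e]
      calc t * Λbar n t ≤ t * (C₀ * ((∫ x, x ^ (2 * α) ∂Λstar) * t ^ (-(2 * α)))) :=
            mul_le_mul_of_nonneg_left (h3.trans (mul_le_mul_of_nonneg_left h2 hC₀.le)) ht.le
        _ = _ := by ring
  have hGW : ∀ n t, 0 < t → Λbar n t ≤ W t := by
    intro n t ht
    by_cases h1 : t ≤ 1
    · rw [hWdef]; simp only [h1, if_true]; exact hG1 n t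
    · push Not at h1
      exact (le_mul_of_one_le_left (hG0 n t) h1.le).trans (hGW' n t ht)
  have iG : ∀ n, IntegrableOn (Λbar n) (Ioi 0) := fun n => by
    refine Integrable.mono' hW (hGm n).aestronglyMeasurable ?_
    refine (ae_restrict_iff' measurableSet_Ioi).2 (Eventually.of_forall fun t ht => ?_)
    rw [Real.norm_of_nonneg (hG0 n t)]; exact hGW n t ht
  have itG : ∀ n, IntegrableOn (fun t => t * Λbar n t) (Ioi 0) := fun n => by
    refine Integrable.mono' hW (measurable_id.mul (hGm n)).aestronglyMeasurable ?_
    refine (ae_restrict_iff' measurableSet_Ioi).2 (Eventually.of_forall fun t ht => ?_)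
    rw [Real.norm_of_nonneg (mul_nonneg (le_of_lt ht) (hG0 n t))]; exact hGW' n t ht
  have hE1 : ∀ n t, 0 ≤ t → Real.exp (-(β * t) / γ n) ≤ 1 := fun n t ht => by
    have := hγ_pos n
    rw [Real.exp_le_one_iff, neg_div]
    have : 0 ≤ β * t / γ n := by positivity
    linarith
  have hEm : ∀ n, Measurable (fun t => Real.exp (-(β * t) / γ n)) := fun n => by fun_prop
  have iE : ∀ n, IntegrableOn (fun t => Real.exp (-(β * t) / γ n) * Λbar n t) (Ioi 0) := fun n => by
    refine Integrable.mono' (iG n) ((hEm n).mul (hGm n)).aestronglyMeasurable ?_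
    refine (ae_restrict_iff' measurableSet_Ioi).2 (Eventually.of_forall fun t ht => ?_)
    rw [Real.norm_of_nonneg (mul_nonneg (Real.exp_pos _).le (hG0 n t))]
    exact mul_le_of_le_one_left (hG0 n t) (hE1 n t (le_of_lt ht))
  have itE : ∀ n, IntegrableOn (fun t => Real.exp (-(β * t) / γ n) * (t * Λbar n t)) (Ioi 0) := fun n => by
    refine Integrable.mono' (itG n) ((hEm n).mul (measurable_id.mul (hGm n))).aestronglyMeasurable ?_
    refine (ae_restrict_iff' measurableSet_Ioi).2 (Eventually.of_forall fun t ht => ?_)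
    have hnn := mul_nonneg (le_of_lt ht) (hG0 n t)
    rw [Real.norm_of_nonneg (mul_nonneg (Real.exp_pos _).le hnn)]
    exact mul_le_of_le_one_left hnn (hE1 n t (le_of_lt ht))
  have m1 : ∀ n, ∫ t in Ioi 0, Λbar n t = ∫ t, t ∂(Λ n) := fun n => by
    have := hΛprob n
    rw [← layer1 (hΛsupp n) (hmom1 n)]; simp_rw [hΛbar]
  have m2 : ∀ n, ∫ t in Ioi 0, t * Λbar n t = (1/2) * ∫ t, t ^ 2 ∂(Λ n) := fun n => by
    have := hΛprob n
    rw [← layer2 (hΛsupp n) (hmom2 n)]; simp_rw [hΛbar]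
  obtain ⟨a, ha⟩ : ∃ a : ℕ → ℝ, a = fun n => lam n * m n := ⟨_, rfl⟩
  have ha_pos : ∀ n, 0 < a n := fun n => by rw [ha]; exact mul_pos (hlam_pos n) (hm_pos n)
  have ha_lim : Tendsto a atTop (nhds lam0) := by
    rw [ha]; simpa using hlam_lim.mul hm_lim
  obtain ⟨f, hf⟩ : ∃ f : ℕ → ℝ → ℝ, f = fun n => (Ici (0:ℝ)).indicator
    (fun t => a n * (Real.exp (-(β * t) / γ n) * Λbar n t)) := ⟨_, rfl⟩
  have hfpos : ∀ n t, 0 ≤ t → f n t = a n * (Real.exp (-(β * t) / γ n) * Λbar n t) := by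
    intro n t ht
    rw [hf]; exact indicator_of_mem (show t ∈ Ici (0:ℝ) from ht) _
  have hfneg : ∀ n t, t < 0 → f n t = 0 := by
    intro n t ht
    rw [hf]; exact indicator_of_notMem (show t ∉ Ici (0:ℝ) from not_le.2 ht) _
  have hfm : ∀ n, Measurable (f n) := fun n => by
    rw [hf]; exact (((hEm n).mul (hGm n)).const_mul _).indicator measurableSet_Ici
  have hf0 : ∀ n t, 0 ≤ f n t := by
    intro n t
    rcases lt_or_ge t 0 with h | h
    · rw [hfneg n t h]
    · rw [hfpos n t h]; exact mul_nonneg (ha_pos n).le (mul_nonneg (Real.exp_pos _).le (hG0 n t))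
  have hfi : ∀ n, Integrable (f n) := fun n => by
    rw [hf]
    refine (integrable_indicator_iff measurableSet_Ici).2 ?_
    exact (integrableOn_Ici_iff_integrableOn_Ioi enorm_ne_top).2 ((iE n).const_mul _)
  have hfI : ∀ n, ∫ t, f n t = a n * ∫ t in Ioi 0, Real.exp (-(β * t) / γ n) * Λbar n t := fun n => by
    rw [hf]; dsimp only
    rw [integral_indicator measurableSet_Ici, integral_Ici_eq_integral_Ioi, integral_const_mul]
  have htf : ∀ n, (fun t => t * f n t) = (Ici (0:ℝ)).indicator
      (fun t => a n * (Real.exp (-(β * t) / γ n) * (t * Λbar n t))) := fun n => by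
    ext t
    rcases lt_or_ge t 0 with h | h
    · rw [hfneg n t h, indicator_of_notMem (show t ∉ Ici (0:ℝ) from not_le.2 h), mul_zero]
    · rw [hfpos n t h, indicator_of_mem (show t ∈ Ici (0:ℝ) from h)]; ring
  have htfi : ∀ n, Integrable (fun t => t * f n t) := fun n => by
    rw [htf]
    refine (integrable_indicator_iff measurableSet_Ici).2 ?_
    exact (integrableOn_Ici_iff_integrableOn_Ioi enorm_ne_top).2 ((itE n).const_mul _)
  have htfI : ∀ n, ∫ t, t * f n t = a n * ∫ t in Ioi 0, Real.exp (-(β * t) / γ n) * (t * Λbar n t) := fun n => by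
    rw [htf, integral_indicator measurableSet_Ici, integral_Ici_eq_integral_Ioi, integral_const_mul]
  have htfI0 : ∀ n, ∫ t in Ioi 0, t * f n t = ∫ t, t * f n t := fun n => by
    rw [htfI, ← integral_const_mul]
    refine setIntegral_congr_fun measurableSet_Ioi fun t ht => ?_
    rw [hfpos n t (le_of_lt ht)]; ring
  have hfanti : ∀ n s t, 0 ≤ s → s ≤ t → f n t ≤ f n s := by
    intro n s t hs hst
    rw [hfpos n t (hs.trans hst), hfpos n s hs]
    refine mul_le_mul_of_nonneg_left ?_ (ha_pos n).le
    refine mul_le_mul ?_ (hGanti n hst) (hG0 n t) (Real.exp_pos _).le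
    have := hγ_pos n
    rw [Real.exp_le_exp]
    gcongr
  have hfle : ∀ n t, f n t ≤ a n := by
    intro n t
    rcases lt_or_ge t 0 with h | h
    · rw [hfneg n t h]; exact (ha_pos n).le
    · rw [hfpos n t h]
      exact mul_le_of_le_one_right (ha_pos n).le (mul_le_one₀ (hE1 n t h) (hG0 n t) (hG1 n t))
  obtain ⟨δ, hδdef⟩ : ∃ δ : ℕ → ℝ, δ = fun n => 1 - ∫ t, f n t := ⟨_, rfl⟩
  obtain ⟨μ, hμdef⟩ : ∃ μ : ℕ → ℝ, μ = fun n => ∫ t, t * f n t := ⟨_, rfl⟩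
  have hμ0 : 0 < σ0 * lam0 := mul_pos hσ0 hlam0
  have hμ : Tendsto μ atTop (nhds (σ0 * lam0)) := by
    have l := lim_mu Λbar W γ β hβ hγ_pos hγ_top hGm hG0 hW hGW'
    have := ha_lim.mul (hsec_lim.sub l)
    rw [sub_zero, mul_comm lam0] at this
    refine this.congr fun n => ?_
    rw [hμdef]; dsimp only
    rw [htfI, ← m2]
    have e : ∫ t in Ioi 0, (1 - Real.exp (-(β * t) / γ n)) * (t * Λbar n t) =
        (∫ t in Ioi 0, t * Λbar n t) - ∫ t in Ioi 0, Real.exp (-(β * t) / γ n) * (t * Λbar n t) := by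
      rw [← integral_sub (itG n) (itE n)]
      congr 1; ext t; ring
    rw [e]; ring
  have hδ : Tendsto (fun n => γ n * δ n) atTop (nhds (bm + β * σ0 * lam0)) := by
    have l := lim_delta Λbar W γ β hβ hγ_pos hγ_top hGm hG0 hW hGW hGW'
    have := hγ_lim.add (ha_lim.mul ((hsec_lim.const_mul β).sub l))
    rw [sub_zero, mul_comm lam0] at this
    refine this.congr fun n => ?_
    rw [hδdef]; dsimp only
    rw [hfI, ← m2, ← m1, ← show a n = lam n * m n by rw [ha]]
    have e : ∫ t in Ioi 0, (β * t - γ n * (1 - Real.exp (-(β * t) / γ n))) * Λbar n t =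
        β * (∫ t in Ioi 0, t * Λbar n t) - γ n * ((∫ t in Ioi 0, Λbar n t) -
          ∫ t in Ioi 0, Real.exp (-(β * t) / γ n) * Λbar n t) := by
      have i3 : IntegrableOn (fun t => γ n * (Λbar n t - Real.exp (-(β * t) / γ n) * Λbar n t)) (Ioi 0) :=
        ((iG n).sub (iE n)).const_mul (γ n)
      rw [← integral_sub (iG n) (iE n), ← integral_const_mul, ← integral_const_mul,
        ← integral_sub ((itG n).const_mul β) i3]
      congr 1; ext t; ring
    rw [e]; ring
  have hδ0 : Tendsto δ atTop (nhds 0) := by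
    have := hγ_top.inv_tendsto_atTop.mul hδ
    rw [zero_mul] at this
    refine this.congr fun n => ?_
    have := (hγ_pos n).ne'
    simp only [Pi.inv_apply]; field_simp
  obtain ⟨B, hB⟩ : ∃ B : ℝ, B = 2 * lam0 := ⟨_, rfl⟩
  have hBpos : 0 < B := by rw [hB]; positivity
  obtain ⟨M, hM⟩ : ∃ M : ℝ, M = 2 * (σ0 * lam0) := ⟨_, rfl⟩
  have hMpos : 0 < M := by rw [hM]; positivity
  have ev1 : ∀ᶠ n in atTop, a n < B := ha_lim.eventually (gt_mem_nhds (by rw [hB]; linarith))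
  have ev2 : ∀ᶠ n in atTop, μ n < M := hμ.eventually (gt_mem_nhds (by rw [hM]; linarith))
  have ev3 : ∀ᶠ n in atTop, 0 < μ n := hμ.eventually (lt_mem_nhds hμ0)
  have ev4 : ∀ᶠ n in atTop, δ n < 1/4 := hδ0.eventually (gt_mem_nhds (by norm_num))
  have ev5 : ∀ᶠ n in atTop, 0 < γ n * δ n := hδ.eventually (lt_mem_nhds hbm_pos)
  have evK : ∀ᶠ n in atTop, Ker (f n) B (δ n) := by
    filter_upwards [ev1, ev5] with n h1 h5
    exact ⟨hfm n, hf0 n, hfneg n, fun t => (hfle n t).trans h1.le, hfi n,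
      by rw [hδdef]; ring, (pos_iff_pos_of_mul_pos h5).1 (hγ_pos n)⟩
  have hs0 : 0 < 1 / (4 * B) := by positivity
  have hc0 : 0 < 1 / (16 * M) := by positivity
  have hT : Tendsto (fun L => B * ∫ t in Ioi L, W t) atTop (nhds 0) := by
    simpa using (tail_zero W hW).const_mul B
  have fin := conv_final f (fun n t => ∑' k, fIter (f n) k t) δ μ γ B
    (3 * B / ((1 / (4 * B)) * (1 / (16 * M)))) (1 / (4 * B)) (1 / (16 * M))
    (bm + β * σ0 * lam0) (σ0 * lam0) (fun L => B * ∫ t in Ioi L, W t) hs0 hc0 hγ_pos hγ_top hbm_pos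
    hμ0 hT hδ hμ (by
      filter_upwards [evK, ev1, ev2, ev3, ev4] with n hK h1 h2 h3 h4
      have hR := ren_exists hK
      obtain ⟨t1, t2⟩ := Hc_total hK (htfi n)
      have hlow := lower hK (htfi n) hBpos (hfanti n) h4.le M hMpos (by rw [hμdef] at h2; exact h2.le)
      have hlo : ∀ s ∈ Ico 0 (1 / (4 * B)), 1 / (16 * M) ≤ f n s := fun s hs =>
        hlow.trans (hfanti n s _ hs.1 hs.2.le)
      refine ⟨hR, t1, ?_, h3, ?_, hlo, ?_⟩
      · rw [t2, htfI0, hμdef]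
      · exact sup_bound hR _ _ hs0 hc0 (by field_simp; norm_num) hlo
      · intro L hL
        obtain ⟨-, t4⟩ := tail_tonelli hK (htfi n) L hL
        rw [t4, ← integral_const_mul]
        have hsub : Ioi L ⊆ Ioi (0:ℝ) := Ioi_subset_Ioi hL
        refine integral_mono_of_nonneg ?_ ((hW.mono_set hsub).const_mul B) ?_
        · refine (ae_restrict_iff' measurableSet_Ioi).2 (Eventually.of_forall fun t ht => ?_)
          exact mul_nonneg (sub_nonneg.2 (le_of_lt ht)) (hf0 n t)
        · refine (ae_restrict_iff' measurableSet_Ioi).2 (Eventually.of_forall fun t ht => ?_)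
          have ht0 : 0 < t := hsub ht
          dsimp only
          have hb : f n t ≤ B * Λbar n t := by
            rw [hfpos n t ht0.le]
            exact mul_le_mul h1.le (mul_le_of_le_one_left (hG0 n t) (hE1 n t ht0.le))
              (mul_nonneg (Real.exp_pos _).le (hG0 n t)) hBpos.le
          calc (t - L) * f n t ≤ t * (B * Λbar n t) :=
                mul_le_mul (by linarith) hb (hf0 n t) ht0.le
            _ = B * (t * Λbar n t) := by ring
            _ ≤ B * W t := mul_le_mul_of_nonneg_left (hGW' n t ht0) hBpos.le) κ hκ
  refine fin.congr' ?_
  filter_upwards [evK] with n hK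
  refine setIntegral_congr_fun measurableSet_Ioi fun t ht => ?_
  have ht : 0 < t := ht
  have e1 : (bm + β * σ0 * lam0) / (σ0 * lam0) = bm / (σ0 * lam0) + β := by
    field_simp
  rw [e1, hRβ, resolvent_eq (a := a n) (g := Λbarβ n) hK (fun s hs => by rw [hfpos n s hs, hΛbarβ])
    (γ n * t) (mul_nonneg (hγ_pos n).le ht.le), ha]
end
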